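/- For each γ ≥ 1 and each ε > 0, the limits lim_{N→∞} (1/N²) log ℙ[H(⌊γN⌋, N) ≤ N((1+√γ)² − ε)] and lim_{N→∞} (1/N) log ℙ[H(⌊γN⌋, N) ≥ N((1+√γ)² + ε)] both exist; that is, there are functions ℓ_*(ε) and i_*(ε) (depending on γ) with lim_{N→∞} (1/N²) log ℙ[H(⌊γN⌋, N) ≤ N((1+√γ)² − ε)] = −ℓ_*(ε) and lim_{N→∞} (1/N) log ℙ[H(⌊γN⌋, N) ≥ N((1+√γ)² + ε)] = −i_*(ε). -/

import Mathlib

open MeasureTheory Filter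

/-- An up/right path from `(1,1)` to `(M,N)`: a sequence of `M+N-1` lattice sites starting at
`(1,1)`, ending at `(M,N)`, each step increasing one coordinate by one. -/
def UpRightPath (M N : ℕ) (π : ℕ → ℕ × ℕ) : Prop :=
  π 0 = (1, 1) ∧ π (M + N - 2) = (M, N) ∧
    ∀ k, k < M + N - 2 →
      π (k + 1) = ((π k).1 + 1, (π k).2) ∨ π (k + 1) = ((π k).1, (π k).2 + 1)

/-- `H(M,N)`: the maximum over up/right paths from `(1,1)` to `(M,N)` of the sum of the
real site weights `u` along the path. -/
noncomputable def lppSupR (u : ℕ × ℕ → ℝ) (M N : ℕ) : ℝ :=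
  sSup {s | ∃ π : ℕ → ℕ × ℕ, UpRightPath M N π ∧
    s = ∑ k ∈ Finset.range (M + N - 1), u (π k)}

/-- The last-passage time to `(m,n)`, defined by its one-site recursion. -/
noncomputable def lastPassage (w : ℕ × ℕ → ℝ) : ℕ → ℕ → ℝ
  | 0, _ => 0
  | _ + 1, 0 => 0
  | m + 1, n + 1 => max (lastPassage w m (n + 1)) (lastPassage w (m + 1) n) + w (m + 1, n + 1)

@[simp] lemma lastPassage_zero_left (w : ℕ × ℕ → ℝ) (n : ℕ) : lastPassage w 0 n = 0 := by
  simp [lastPassage]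

@[simp] lemma lastPassage_zero_right (w : ℕ × ℕ → ℝ) (m : ℕ) : lastPassage w m 0 = 0 := by
  cases m <;> simp [lastPassage]

lemma lastPassage_succ (w : ℕ × ℕ → ℝ) (m n : ℕ) :
    lastPassage w (m + 1) (n + 1) =
      max (lastPassage w m (n + 1)) (lastPassage w (m + 1) n) + w (m + 1, n + 1) := by
  simp [lastPassage]

lemma lastPassage_nonneg {w : ℕ × ℕ → ℝ} (hw : ∀ p, 0 ≤ w p) (m n : ℕ) :
    0 ≤ lastPassage w m n := by
  induction m generalizing n with
  | zero => simp
  | succ m ih =>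
    cases n with
    | zero => simp
    | succ n =>
      rw [lastPassage_succ]
      exact add_nonneg (le_max_of_le_left (ih _)) (hw _)

lemma lastPassage_le_succ_left {w : ℕ × ℕ → ℝ} (hw : ∀ p, 0 ≤ w p) (m n : ℕ) :
    lastPassage w m n ≤ lastPassage w (m + 1) n := by
  cases n with
  | zero => simp
  | succ n =>
    rw [lastPassage_succ]
    linarith [le_max_left (lastPassage w m (n + 1)) (lastPassage w (m + 1) n), hw (m + 1, n + 1)]

lemma lastPassage_le_succ_right {w : ℕ × ℕ → ℝ} (hw : ∀ p, 0 ≤ w p) (m n : ℕ) :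
    lastPassage w m n ≤ lastPassage w m (n + 1) := by
  cases m with
  | zero => simp
  | succ m =>
    rw [lastPassage_succ]
    linarith [le_max_right (lastPassage w m (n + 1)) (lastPassage w (m + 1) n), hw (m + 1, n + 1)]

lemma lastPassage_mono {w : ℕ × ℕ → ℝ} (hw : ∀ p, 0 ≤ w p) {m m' n n' : ℕ}
    (hm : m ≤ m') (hn : n ≤ n') : lastPassage w m n ≤ lastPassage w m' n' :=
  (monotone_nat_of_le_succ (fun k => lastPassage_le_succ_left hw k n) hm).trans
    (monotone_nat_of_le_succ (fun k => lastPassage_le_succ_right hw m' k) hn)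

/-- Superadditivity of last-passage times under concatenation of boxes. -/
lemma lastPassage_add_le {w : ℕ × ℕ → ℝ} (hw : ∀ p, 0 ≤ w p) (a b m n : ℕ) :
    lastPassage w a b + lastPassage (fun p => w (a + p.1, b + p.2)) m n ≤
      lastPassage w (a + m) (b + n) := by
  induction m generalizing n with
  | zero => simpa using lastPassage_mono hw le_rfl (Nat.le_add_right b n)
  | succ m ihm =>
    induction n with
    | zero => simpa using lastPassage_mono hw (Nat.le_add_right a (m + 1)) le_rfl
    | succ n ihn =>
      calc _ = max (lastPassage w a b + lastPassage (fun p => w (a + p.1, b + p.2)) m (n + 1))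
              (lastPassage w a b + lastPassage (fun p => w (a + p.1, b + p.2)) (m + 1) n) +
              w (a + m + 1, b + n + 1) := by
            rw [lastPassage_succ, max_add_add_left, ← add_assoc]; rfl
        _ ≤ max (lastPassage w (a + m) (b + n + 1)) (lastPassage w (a + m + 1) (b + n)) +
              w (a + m + 1, b + n + 1) := add_le_add_left (max_le_max (ihm (n + 1)) ihn) _
        _ = _ := (lastPassage_succ w (a + m) (b + n)).symm

/-- An up/right path ending at `(m + 1, n + 1)` that realises the last-passage time. -/
lemma exists_upRightPath_sum_eq {w : ℕ × ℕ → ℝ} (hw : ∀ p, 0 ≤ w p) (m n : ℕ) :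
    ∃ π : ℕ → ℕ × ℕ, UpRightPath (m + 1) (n + 1) π ∧
      lastPassage w (m + 1) (n + 1) = ∑ k ∈ Finset.range (m + n + 1), w (π k) := by
  have key : ∀ s m n : ℕ, m + n = s → ∃ π : ℕ → ℕ × ℕ, π 0 = (1, 1) ∧ π (m + n) = (m + 1, n + 1) ∧
      (∀ k, k < m + n → π (k + 1) = ((π k).1 + 1, (π k).2) ∨ π (k + 1) = ((π k).1, (π k).2 + 1)) ∧
      lastPassage w (m + 1) (n + 1) = ∑ k ∈ Finset.range (m + n + 1), w (π k) := by
    intro s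
    induction s with
    | zero =>
      intro m n h
      obtain ⟨rfl, rfl⟩ : m = 0 ∧ n = 0 := by omega
      exact ⟨fun _ => (1, 1), rfl, rfl, by simp, by simp [lastPassage_succ]⟩
    | succ s ih =>
      intro m n h
      have ext : ∀ m' n' : ℕ, m' + n' = s →
          ((m + 1, n + 1) = (m' + 1 + 1, n' + 1) ∨ (m + 1, n + 1) = (m' + 1, n' + 1 + 1)) →
          lastPassage w (m + 1) (n + 1) =
            lastPassage w (m' + 1) (n' + 1) + w (m + 1, n + 1) →
          ∃ π : ℕ → ℕ × ℕ, π 0 = (1, 1) ∧ π (m + n) = (m + 1, n + 1) ∧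
            (∀ k, k < m + n →
              π (k + 1) = ((π k).1 + 1, (π k).2) ∨ π (k + 1) = ((π k).1, (π k).2 + 1)) ∧
            lastPassage w (m + 1) (n + 1) = ∑ k ∈ Finset.range (m + n + 1), w (π k) := by
        intro m' n' h' hstep hval
        obtain ⟨π, h0, hend, hst, hsum⟩ := ih m' n' h'
        rw [h'] at hend hst hsum
        refine ⟨fun k => if k ≤ s then π k else (m + 1, n + 1), by simpa using h0, ?_, ?_, ?_⟩
        · simp [h]
        · intro k hk
          rcases Nat.lt_or_ge k s with hks | hks
          · simpa [hks.le, Nat.succ_le_of_lt hks] using hst k hks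
          · obtain rfl : k = s := by omega
            simpa [hend] using hstep
        · rw [h, Finset.sum_range_succ, hval, hsum]
          simp only [show ¬ (s + 1 ≤ s) by omega, if_false]
          congr 1
          refine Finset.sum_congr rfl fun k hk => ?_
          rw [if_pos (by simpa [Nat.lt_succ_iff] using hk)]
      rcases le_total (lastPassage w m (n + 1)) (lastPassage w (m + 1) n) with hle | hle
      · cases n with
        | zero =>
          cases m with
          | zero => omega
          | succ m =>
            refine ext m 0 (by omega) (Or.inl rfl) ?_
            rw [lastPassage_succ w (m + 1) 0, lastPassage_zero_right,
              max_eq_left (lastPassage_nonneg hw _ _)]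
        | succ n =>
          refine ext m n (by omega) (Or.inr rfl) ?_
          rw [lastPassage_succ w m (n + 1), max_eq_right hle]
      · cases m with
        | zero =>
          cases n with
          | zero => omega
          | succ n =>
            refine ext 0 n (by omega) (Or.inr rfl) ?_
            rw [lastPassage_succ w 0 (n + 1), lastPassage_zero_left,
              max_eq_right (lastPassage_nonneg hw _ _)]
        | succ m =>
          refine ext m n (by omega) (Or.inl rfl) ?_
          rw [lastPassage_succ w (m + 1) n, max_eq_left hle]
  obtain ⟨π, h0, h1, h2, h3⟩ := key _ m n rfl
  have e : m + 1 + (n + 1) - 2 = m + n := by omega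
  exact ⟨π, ⟨h0, by rw [e]; exact h1, by rw [e]; exact h2⟩, h3⟩

lemma sum_upRightPath_le {w : ℕ × ℕ → ℝ} {m n : ℕ} (π : ℕ → ℕ × ℕ)
    (hπ : UpRightPath (m + 1) (n + 1) π) :
    ∑ k ∈ Finset.range (m + n + 1), w (π k) ≤ lastPassage w (m + 1) (n + 1) := by
  obtain ⟨h0, h1, h2⟩ := hπ
  rw [show m + 1 + (n + 1) - 2 = m + n by omega] at h1 h2
  have key : ∀ j ≤ m + n, 1 ≤ (π j).1 ∧ 1 ≤ (π j).2 ∧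
      ∑ k ∈ Finset.range (j + 1), w (π k) ≤ lastPassage w (π j).1 (π j).2 := by
    intro j
    induction j with
    | zero => intro _; simp [h0, lastPassage]
    | succ j ih =>
      intro hj
      obtain ⟨ha, hb, hs⟩ := ih (by omega)
      rw [Finset.sum_range_succ]
      obtain ⟨a, ha'⟩ := Nat.exists_eq_add_of_le' ha
      obtain ⟨b, hb'⟩ := Nat.exists_eq_add_of_le' hb
      rw [ha', hb'] at hs
      rcases h2 j (by omega) with h | h
      · rw [h]
        simp only [ha', hb'] at *
        refine ⟨by omega, by omega, ?_⟩
        rw [lastPassage_succ w (a + 1) b]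
        exact add_le_add_left (hs.trans (le_max_left _ _)) _
      · rw [h]
        simp only [ha', hb'] at *
        refine ⟨by omega, by omega, ?_⟩
        rw [lastPassage_succ w a (b + 1)]
        exact add_le_add_left (hs.trans (le_max_right _ _)) _
  have := (key _ le_rfl).2.2
  rwa [h1] at this

lemma lppSupR_eq_lastPassage {w : ℕ × ℕ → ℝ} (hw : ∀ p, 0 ≤ w p) {M N : ℕ}
    (hM : 1 ≤ M) (hN : 1 ≤ N) : lppSupR w M N = lastPassage w M N := by
  obtain ⟨m, rfl⟩ := Nat.exists_eq_add_of_le' hM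
  obtain ⟨n, rfl⟩ := Nat.exists_eq_add_of_le' hN
  have e : m + 1 + (n + 1) - 1 = m + n + 1 := by omega
  refine IsGreatest.csSup_eq ⟨?_, ?_⟩
  · rw [e]
    exact exists_upRightPath_sum_eq hw m n
  · rintro s ⟨π, hπ, rfl⟩
    rw [e]
    exact sum_upRightPath_le π hπ

section Weights

open ProbabilityTheory

lemma measurable_lastPassage_of_le {Ω : Type*} {m₀ : MeasurableSpace Ω} {w : ℕ × ℕ → Ω → ℝ}
    {m n : ℕ} (h : ∀ p : ℕ × ℕ, p.1 ≤ m → p.2 ≤ n → Measurable[m₀] (w p)) :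
    Measurable[m₀] fun ω => lastPassage (fun p => w p ω) m n := by
  induction m generalizing n with
  | zero => simp
  | succ m ihm =>
    induction n with
    | zero => simp
    | succ n ihn =>
      simp only [lastPassage_succ]
      refine Measurable.add (Measurable.max (ihm fun p h1 h2 => h p (h1.trans (by omega)) h2)
        (ihn fun p h1 h2 => h p h1 (h2.trans (by omega)))) (h _ le_rfl le_rfl)

/-- The σ-algebra generated by the weights at the sites of `S`. -/
abbrev weightSigma {Ω : Type*} (v : ℕ × ℕ → Ω → ℝ) (S : Set (ℕ × ℕ)) : MeasurableSpace Ω :=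
  ⨆ p ∈ S, MeasurableSpace.comap (v p) inferInstance

lemma measurable_weightSigma {Ω : Type*} (v : ℕ × ℕ → Ω → ℝ) {S : Set (ℕ × ℕ)}
    {p : ℕ × ℕ} (hp : p ∈ S) :
    Measurable[weightSigma v S] (v p) :=
  (comap_measurable (v p)).mono (le_iSup₂_of_le p hp le_rfl) le_rfl

variable {Ω : Type*} [MeasurableSpace Ω]

/-- Nonnegative i.i.d. exponential weights of rate one. -/
structure IsExpWeights (μ : Measure Ω) (v : ℕ × ℕ → Ω → ℝ) : Prop where
  measurable : ∀ p, Measurable (v p)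
  nonneg : ∀ p ω, 0 ≤ v p ω
  indep : iIndepFun v μ
  cdf : ∀ p t, 0 ≤ t → μ {ω | v p ω ≤ t} = ENNReal.ofReal (1 - Real.exp (-t))

variable {μ : Measure Ω} {v : ℕ × ℕ → Ω → ℝ}

lemma IsExpWeights.map_eq [IsProbabilityMeasure μ] (hv : IsExpWeights μ v) (p : ℕ × ℕ) :
    μ.map (v p) = expMeasure 1 := by
  have := isProbabilityMeasure_expMeasure one_pos
  have := Measure.isProbabilityMeasure_map (μ := μ) (hv.measurable p).aemeasurable
  refine Measure.eq_of_cdf _ _ ?_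
  ext x
  rw [cdf_expMeasure_eq one_pos, cdf_eq_real, Measure.real,
    Measure.map_apply (hv.measurable p) measurableSet_Iic]
  change (μ {ω | v p ω ≤ x}).toReal = _
  split_ifs with hx
  · rw [hv.cdf p x hx, one_mul, ENNReal.toReal_ofReal]
    simpa using hx
  · rw [show {ω | v p ω ≤ x} = ∅ from ?_]
    · simp
    · ext ω
      simp only [Set.mem_ofPred_eq, Set.mem_empty_iff_false, iff_false, not_le]
      exact (not_le.1 hx).trans_le (hv.nonneg p ω)

lemma IsExpWeights.measurable_lastPassage (hv : IsExpWeights μ v) (m n : ℕ) :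
    Measurable fun ω => lastPassage (fun p => v p ω) m n :=
  measurable_lastPassage_of_le fun p _ _ => hv.measurable p

lemma IsExpWeights.indep_weightSigma (hv : IsExpWeights μ v) {S T : Set (ℕ × ℕ)}
    (hST : Disjoint S T) : Indep (weightSigma v S) (weightSigma v T) μ :=
  indep_iSup_of_disjoint (fun p => (hv.measurable p).comap_le) hv.indep hST

lemma IsExpWeights.indepFun (hv : IsExpWeights μ v) {S T : Set (ℕ × ℕ)} (hST : Disjoint S T)
    {α β : Type*} [MeasurableSpace α] [MeasurableSpace β] {X : Ω → α} {Y : Ω → β}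
    (hX : Measurable[weightSigma v S] X) (hY : Measurable[weightSigma v T] Y) :
    IndepFun X Y μ :=
  (IndepFun_iff_Indep _ _ _).2 <|
    indep_of_indep_of_le_left (indep_of_indep_of_le_right (hv.indep_weightSigma hST) hY.comap_le)
      hX.comap_le

lemma IsExpWeights.shift (hv : IsExpWeights μ v) (a b : ℕ) :
    IsExpWeights μ fun p => v (a + p.1, b + p.2) where
  measurable p := hv.measurable _
  nonneg p := hv.nonneg _
  indep := hv.indep.precomp (g := fun p : ℕ × ℕ => (a + p.1, b + p.2)) fun p q h => by
    simpa [Prod.ext_iff] using h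
  cdf p := hv.cdf _

lemma IsExpWeights.measure_lastPassage_eq [IsProbabilityMeasure μ] {v' : ℕ × ℕ → Ω → ℝ}
    (hv : IsExpWeights μ v) (hv' : IsExpWeights μ v') (m n : ℕ) {s : Set ℝ} (hs : MeasurableSet s) :
    μ {ω | lastPassage (fun p => v p ω) m n ∈ s} =
      μ {ω | lastPassage (fun p => v' p ω) m n ∈ s} := by
  have hlaw : ∀ {w : ℕ × ℕ → Ω → ℝ}, IsExpWeights μ w →
      μ {ω | lastPassage (fun p => w p ω) m n ∈ s} =
        Measure.infinitePi (fun _ : ℕ × ℕ => expMeasure 1) {x | lastPassage x m n ∈ s} := by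
    intro w hw
    have h := (iIndepFun_iff_map_fun_eq_infinitePi_map hw.measurable).1 hw.indep
    simp only [hw.map_eq] at h
    rw [← h, Measure.map_apply (measurable_pi_lambda _ hw.measurable)]
    · rfl
    · exact (measurable_lastPassage_of_le (w := fun p (x : ℕ × ℕ → ℝ) => x p)
        fun p _ _ => measurable_pi_apply p) hs
  rw [hlaw hv, hlaw hv']

end Weights

section UpperTail

open ProbabilityTheory

variable {Ω : Type*} [MeasurableSpace Ω] {μ : Measure Ω} [IsProbabilityMeasure μ]
  {v : ℕ × ℕ → Ω → ℝ}

lemma IsExpWeights.measure_ge_pos (hv : IsExpWeights μ v) (p : ℕ × ℕ) (x : ℝ) :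
    0 < μ {ω | x ≤ v p ω} := by
  have h1 : μ {ω | v p ω ≤ max x 0} < 1 := by
    rw [hv.cdf p _ (le_max_right _ _), ENNReal.ofReal_lt_one]
    linarith [Real.exp_pos (-max x 0)]
  have h2 : {ω | v p ω ≤ max x 0}ᶜ ⊆ {ω | x ≤ v p ω} := fun ω hω =>
    (le_max_left x 0).trans (not_le.1 (show ¬ v p ω ≤ max x 0 from hω)).le
  refine lt_of_lt_of_le ?_ (measure_mono h2)
  rw [prob_compl_eq_one_sub (measurableSet_le (hv.measurable p) measurable_const)]
  exact tsub_pos_of_lt h1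

lemma IsExpWeights.measure_lastPassage_ge_pos (hv : IsExpWeights μ v) {m n : ℕ} (hm : 1 ≤ m)
    (hn : 1 ≤ n) (x : ℝ) : 0 < μ {ω | x ≤ lastPassage (fun p => v p ω) m n} := by
  obtain ⟨m, rfl⟩ := Nat.exists_eq_add_of_le' hm
  obtain ⟨n, rfl⟩ := Nat.exists_eq_add_of_le' hn
  refine (hv.measure_ge_pos (m + 1, n + 1) x).trans_le (measure_mono fun ω hω => ?_)
  simp only [Set.mem_ofPred_eq, lastPassage_succ] at hω ⊢
  have := lastPassage_nonneg (fun p => hv.nonneg p ω) m (n + 1)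
  linarith [le_max_left (lastPassage (fun p => v p ω) m (n + 1))
    (lastPassage (fun p => v p ω) (m + 1) n)]

lemma IsExpWeights.measure_ge_mul_le (hv : IsExpWeights μ v) (a b m n : ℕ) (x y : ℝ) :
    μ {ω | x ≤ lastPassage (fun p => v p ω) a b} * μ {ω | y ≤ lastPassage (fun p => v p ω) m n} ≤
      μ {ω | x + y ≤ lastPassage (fun p => v p ω) (a + m) (b + n)} := by
  have hind : IndepFun (fun ω => lastPassage (fun p => v p ω) a b)
      (fun ω => lastPassage (fun p => v (a + p.1, b + p.2) ω) m n) μ := by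
    have hX : Measurable[weightSigma v {p | p.1 ≤ a ∧ p.2 ≤ b}]
        fun ω => lastPassage (fun p => v p ω) a b :=
      measurable_lastPassage_of_le fun p h1 h2 => measurable_weightSigma v ⟨h1, h2⟩
    have hY : Measurable[weightSigma v {p | p.1 ≤ a ∧ p.2 ≤ b}ᶜ]
        fun ω => lastPassage (fun p => v (a + p.1, b + p.2) ω) m n := by
      have h0 : ∀ m n, Measurable[weightSigma v {p | p.1 ≤ a ∧ p.2 ≤ b}ᶜ]
          fun ω => lastPassage (fun p => v (a + p.1, b + p.2) ω) m n := by
        intro m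
        induction m with
        | zero => intro n; simp
        | succ m ihm =>
          intro n
          induction n with
          | zero => simp
          | succ n ihn =>
            simp only [lastPassage_succ]
            refine Measurable.add (Measurable.max (ihm _) ihn) (measurable_weightSigma v ?_)
            simp only [Set.mem_compl_iff, Set.mem_ofPred_eq]
            omega
      exact h0 m n
    exact hv.indepFun disjoint_compl_right hX hY
  calc _ = μ {ω | x ≤ lastPassage (fun p => v p ω) a b} *
        μ {ω | y ≤ lastPassage (fun p => v (a + p.1, b + p.2) ω) m n} := by
        congr 1
        exact hv.measure_lastPassage_eq (hv.shift a b) m n (s := Set.Ici y) measurableSet_Ici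
    _ = μ ({ω | x ≤ lastPassage (fun p => v p ω) a b} ∩
        {ω | y ≤ lastPassage (fun p => v (a + p.1, b + p.2) ω) m n}) :=
        (hind.measure_inter_preimage_eq_mul (Set.Ici x) (Set.Ici y)
          measurableSet_Ici measurableSet_Ici).symm
    _ ≤ _ := measure_mono fun ω hω =>
        (add_le_add hω.1 hω.2).trans (lastPassage_add_le (fun p => hv.nonneg p ω) a b m n)

theorem IsExpWeights.exists_tendsto_upperTail (hv : IsExpWeights μ v) {γ : ℝ} (hγ : 1 ≤ γ)
    (a : ℝ) : ∃ i : ℝ, Tendsto (fun N : ℕ => (1 / (N : ℝ)) *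
      Real.log (μ {ω | N * a ≤ lastPassage (fun p => v p ω) ⌊γ * N⌋₊ N}).toReal)
        atTop (nhds (-i)) := by
  set p : ℕ → ℝ := fun N =>
    (μ {ω | N * a ≤ lastPassage (fun p => v p ω) ⌊γ * N⌋₊ N}).toReal with hp
  have hpos : ∀ N, 0 < p N := by
    intro N
    refine ENNReal.toReal_pos ?_ (measure_ne_top _ _)
    rcases Nat.eq_zero_or_pos N with rfl | hN
    · simp
    · refine (hv.measure_lastPassage_ge_pos ?_ hN _).ne'
      refine Nat.le_floor ?_
      have : (1 : ℝ) ≤ N := by exact_mod_cast hN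
      push_cast
      nlinarith
  have hle : ∀ N, p N ≤ 1 := fun N => measureReal_le_one
  have hmul : ∀ m n, p m * p n ≤ p (m + n) := by
    intro m n
    rw [hp]
    simp only
    rw [← ENNReal.toReal_mul]
    refine ENNReal.toReal_mono (measure_ne_top _ _) ((hv.measure_ge_mul_le _ _ _ _ _ _).trans
      (measure_mono fun ω hω => ?_))
    simp only [Set.mem_ofPred_eq] at hω ⊢
    have hfl : ⌊γ * m⌋₊ + ⌊γ * n⌋₊ ≤ ⌊γ * (m + n : ℕ)⌋₊ := by
      refine Nat.le_floor ?_
      push_cast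
      rw [mul_add]
      exact add_le_add (Nat.floor_le (by positivity)) (Nat.floor_le (by positivity))
    calc ((m + n : ℕ) : ℝ) * a = m * a + n * a := by push_cast; ring
      _ ≤ _ := hω
      _ ≤ _ := lastPassage_mono (fun p => hv.nonneg p ω) hfl le_rfl
  have hsub : Subadditive fun N => -Real.log (p N) := by
    intro m n
    have := Real.log_le_log (mul_pos (hpos m) (hpos n)) (hmul m n)
    rw [Real.log_mul (hpos m).ne' (hpos n).ne'] at this
    linarith
  have hbdd : BddBelow (Set.range fun n : ℕ => -Real.log (p n) / n) := by
    refine ⟨0, ?_⟩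
    rintro _ ⟨n, rfl⟩
    have := Real.log_nonpos (hpos n).le (hle n)
    exact div_nonneg (by linarith) (Nat.cast_nonneg n)
  refine ⟨hsub.lim, (hsub.tendsto_lim hbdd).neg.congr fun N => ?_⟩
  ring

end UpperTail

section Determinant

lemma hasDerivWithinAt_det {n : Type*} [Fintype n] [DecidableEq n] {A : ℝ → Matrix n n ℝ}
    {A' : Matrix n n ℝ} {S : Set ℝ} {x : ℝ}
    (h : ∀ i j, HasDerivWithinAt (fun s => A s i j) (A' i j) S x) :
    HasDerivWithinAt (fun s => (A s).det)
      (∑ j, ((A x).updateCol j fun i => A' i j).det) S x := by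
  have key : HasDerivWithinAt (fun s => (A s).det)
      (∑ σ : Equiv.Perm n, ((Equiv.Perm.sign σ : ℤ) : ℝ) *
        ∑ j, (∏ l ∈ Finset.univ.erase j, A x (σ l) l) • A' (σ j) j) S x := by
    simp only [Matrix.det_apply']
    exact HasDerivWithinAt.fun_sum fun σ _ =>
      (HasDerivWithinAt.fun_finsetProd fun j _ => h (σ j) j).const_mul _
  convert key using 1
  simp only [Matrix.det_apply', Finset.mul_sum]
  rw [Finset.sum_comm]
  refine Finset.sum_congr rfl fun σ _ => Finset.sum_congr rfl fun j _ => ?_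
  rw [← Finset.mul_prod_erase Finset.univ _ (Finset.mem_univ j), Matrix.updateCol_self,
    smul_eq_mul, mul_comm (A' (σ j) j)]
  congr 2
  refine Finset.prod_congr rfl fun l hl => ?_
  rw [Matrix.updateCol_ne (Finset.ne_of_mem_erase hl)]

/-- The `k`-th derivative on `[0,∞)` of the `(N-1)`-fold primitive of the distribution function of
a sum of `m` independent exponential variables. -/
noncomputable def gammaJet (N : ℕ) : ℕ → ℕ → ℝ → ℝ
  | 0, k => fun t => if k < N then t ^ (N - 1 - k) / (N - 1 - k).factorial else 0
  | m + 1, 0 => fun t => Real.exp (-t) * ∫ s in (0 : ℝ)..t, Real.exp s * gammaJet N m 0 s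
  | m + 1, k + 1 => fun t => gammaJet N m k t - gammaJet N (m + 1) k t

lemma gammaJet_succ_succ (N m k : ℕ) (t : ℝ) :
    gammaJet N (m + 1) (k + 1) t = gammaJet N m k t - gammaJet N (m + 1) k t := by
  simp [gammaJet]

lemma hasDerivAt_gammaJet (N m k : ℕ) (t : ℝ) :
    HasDerivAt (gammaJet N m k) (gammaJet N m (k + 1) t) t := by
  induction m generalizing k t with
  | zero =>
    by_cases hk : k + 1 < N
    · obtain ⟨d, rfl⟩ : ∃ d, N = k + 2 + d := ⟨N - (k + 2), by omega⟩
      have h := (hasDerivAt_pow (d + 1) t).div_const ((d + 1).factorial : ℝ)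
      have e1 : k + 2 + d - 1 - k = d + 1 := by omega
      have e2 : k + 2 + d - 1 - (k + 1) = d := by omega
      have e3 : gammaJet (k + 2 + d) 0 k = fun t => t ^ (d + 1) / ((d + 1).factorial : ℝ) := by
        funext t
        simp only [gammaJet, e1]
        rw [if_pos (by omega)]
      rw [e3]
      refine h.congr_deriv ?_
      simp only [gammaJet, e2, hk, if_true, Nat.factorial_succ, Nat.add_sub_cancel]
      push_cast
      field_simp
    · have e4 : gammaJet N 0 (k + 1) t = 0 := by simp [gammaJet, hk]
      rw [e4]
      by_cases hk' : k < N
      · have e : N - 1 - k = 0 := by omega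
        have : gammaJet N 0 k = fun _ => 1 := by
          funext t
          simp [gammaJet, hk', e]
        rw [this]
        exact hasDerivAt_const t 1
      · have : gammaJet N 0 k = fun _ => 0 := by
          funext t
          simp [gammaJet, hk']
        rw [this]
        exact hasDerivAt_const t 0
  | succ m ihm =>
    induction k generalizing t with
    | zero =>
      have hc : Continuous fun s => Real.exp s * gammaJet N m 0 s :=
        Real.continuous_exp.mul
          (continuous_iff_continuousAt.2 fun s => (ihm 0 s).continuousAt)
      have h1 := intervalIntegral.integral_hasDerivAt_right (hc.intervalIntegrable 0 t)
        (hc.stronglyMeasurableAtFilter _ _) hc.continuousAt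
      have h2 : HasDerivAt (fun t => Real.exp (-t)) (-Real.exp (-t)) t := by
        simpa using (hasDerivAt_id t).neg.exp
      have e3 : gammaJet N (m + 1) 0 = fun t =>
          Real.exp (-t) * ∫ s in (0 : ℝ)..t, Real.exp s * gammaJet N m 0 s := by
        funext t
        simp [gammaJet]
      rw [gammaJet_succ_succ, e3]
      refine (h2.mul h1).congr_deriv ?_
      rw [← mul_assoc, ← Real.exp_add, neg_add_cancel, Real.exp_zero]
      ring
    | succ k ihk =>
      rw [gammaJet_succ_succ]
      have e : gammaJet N (m + 1) (k + 1) =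
          fun t => gammaJet N m k t - gammaJet N (m + 1) k t := by
        funext t
        rw [gammaJet_succ_succ]
      rw [e]
      exact ((ihm k t).sub (ihk t)).congr_deriv (by rw [gammaJet_succ_succ])

lemma continuous_gammaJet (N m k : ℕ) : Continuous (gammaJet N m k) :=
  continuous_iff_continuousAt.2 fun s => (hasDerivAt_gammaJet N m k s).continuousAt

lemma gammaJet_zero_zero {N k : ℕ} (hk : k + 1 < N) : gammaJet N 0 k 0 = 0 := by
  simp [gammaJet, show N - 1 - k ≠ 0 by omega]

lemma gammaJet_succ_zero {N : ℕ} (m : ℕ) {k : ℕ} (hk : k < N) : gammaJet N (m + 1) k 0 = 0 := by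
  induction m generalizing k with
  | zero =>
    induction k with
    | zero => simp [gammaJet]
    | succ k ihk => rw [gammaJet_succ_succ, ihk (by omega), gammaJet_zero_zero hk, sub_zero]
  | succ m ihm =>
    induction k with
    | zero => simp [gammaJet]
    | succ k ihk => rw [gammaJet_succ_succ, ihk (by omega), ihm (by omega), sub_zero]

/-- The determinant which gives the joint distribution function of last-passage times along
a column whose `j`-th entry is in row `e j`. -/
noncomputable def jointDet (N : ℕ) (e : Fin N → ℕ) (t : Fin N → ℝ) : ℝ :=
  (Matrix.of fun i j : Fin N => gammaJet N (e j) (N - 1 - i + j) (t j)).det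

lemma continuous_jointDet (N : ℕ) (e : Fin N → ℕ) : Continuous (jointDet N e) := by
  refine Continuous.matrix_det (continuous_matrix fun i j => ?_)
  exact (continuous_gammaJet _ _ _).comp (continuous_apply j)

/-- The thresholds that the earlier passage times must meet for the site `k` to be entered
by time `s`. -/
noncomputable def cutThreshold {N : ℕ} (t : Fin N → ℝ) (k : Fin N) (s : ℝ) (i : Fin N) : ℝ :=
  if i < k then min (t i) s else if i = k then s else t i

lemma continuous_cutThreshold {N : ℕ} (t : Fin N → ℝ) (k : Fin N) :
    Continuous (cutThreshold t k) := by
  refine continuous_pi fun i => ?_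
  unfold cutThreshold
  split_ifs <;> fun_prop

lemma cutThreshold_monotone {N : ℕ} {t : Fin N → ℝ} (ht : Monotone t) {k : Fin N} {s : ℝ}
    (hs : s ≤ t k) : Monotone (cutThreshold t k s) := by
  intro i j hij
  have h1 := ht hij
  unfold cutThreshold
  split_ifs with h2 h3 h4 h5 h6 h7 h8
  · exact min_le_min_right s h1
  · exact min_le_right _ _
  · exact (min_le_left _ _).trans h1
  · omega
  · exact le_rfl
  · exact hs.trans (ht (by omega))
  · omega
  · omega
  · exact h1

lemma cutThreshold_nonneg {N : ℕ} {t : Fin N → ℝ} (ht : ∀ i, 0 ≤ t i) (k : Fin N) {s : ℝ}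
    (hs : 0 ≤ s) (i : Fin N) : 0 ≤ cutThreshold t k s i := by
  unfold cutThreshold
  split_ifs
  · exact le_min (ht i) hs
  · exact hs
  · exact ht i

lemma cutThreshold_self {N : ℕ} {t : Fin N → ℝ} (ht : Monotone t) (k : Fin N) :
    cutThreshold t k (t k) = t := by
  funext i
  unfold cutThreshold
  split_ifs with h1 h2
  · exact min_eq_left (ht h1.le)
  · rw [h2]
  · rfl

lemma hasDerivWithinAt_cutThreshold {N : ℕ} (t : Fin N → ℝ) (k : Fin N) (s : ℝ) (i : Fin N) :
    HasDerivWithinAt (fun s => cutThreshold t k s i)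
      (if (i < k ∧ s < t i) ∨ i = k then 1 else 0) (Set.Ioi s) s := by
  unfold cutThreshold
  by_cases h1 : i < k
  · simp only [h1, if_true, true_and, h1.ne, or_false]
    split_ifs with h2
    · refine ((hasDerivAt_id s).congr_of_eventuallyEq ?_).hasDerivWithinAt
      filter_upwards [gt_mem_nhds h2] with x hx
      simp [min_eq_right hx.le]
    · refine (hasDerivWithinAt_const s (Set.Ioi s) (t i)).congr (fun x hx => ?_) ?_
      · exact min_eq_left ((not_lt.1 h2).trans (le_of_lt hx))
      · exact min_eq_left (not_lt.1 h2)
  · by_cases h2 : i = k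
    · simp only [h2, lt_self_iff_false, if_false, if_true, or_true]
      exact hasDerivWithinAt_id _ _
    · simp only [h1, h2, if_false, false_and, or_false]
      exact hasDerivWithinAt_const _ _ _

/-- The determinantal distribution functions satisfy the one-site evolution equation. -/
lemma jointDet_step {N m : ℕ} {e e' : Fin N → ℕ} {k : Fin N} (hk : e k = m)
    (he' : ∀ i, i ≤ k → e' i = m + 1) (hee : ∀ i, k < i → e' i = e i)
    (hel : ∀ i, i < k → e i = m + 1) {t : Fin N → ℝ}
    (ht : Monotone t) (ht0 : ∀ i, 0 ≤ t i) :
    ∫ s in (0 : ℝ)..t k, Real.exp s * jointDet N e (cutThreshold t k s) =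
      Real.exp (t k) * jointDet N e' t := by
  have hcont : Continuous fun s => Real.exp s * jointDet N e (cutThreshold t k s) :=
    Real.continuous_exp.mul ((continuous_jointDet N e).comp (continuous_cutThreshold t k))
  have hcont' : Continuous fun s => Real.exp s * jointDet N e' (cutThreshold t k s) :=
    Real.continuous_exp.mul ((continuous_jointDet N e').comp (continuous_cutThreshold t k))
  have hN : 0 < N := k.pos
  have hzero : jointDet N e' (cutThreshold t k 0) = 0 := by
    refine Matrix.det_eq_zero_of_column_eq_zero ⟨0, hN⟩ fun i => ?_
    have h1 : cutThreshold t k 0 ⟨0, hN⟩ = 0 := by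
      unfold cutThreshold
      split_ifs with h1 h2
      · exact min_eq_right (ht0 _)
      · rfl
      · exfalso
        have : (k : ℕ) ≠ 0 := fun h => h2 (Fin.ext h.symm)
        exact h1 (Fin.lt_def.2 (Nat.pos_of_ne_zero this))
    rw [Matrix.of_apply, h1, he' _ (Fin.le_def.2 (Nat.zero_le _))]
    exact gammaJet_succ_zero m (by simp only []; omega)
  have hderiv : ∀ s, HasDerivWithinAt (fun s => Real.exp s * jointDet N e' (cutThreshold t k s))
      (Real.exp s * jointDet N e (cutThreshold t k s)) (Set.Ioi s) s := by
    intro s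
    have hdet := hasDerivWithinAt_det (S := Set.Ioi s) (x := s)
      (A := fun s => Matrix.of fun i j : Fin N =>
        gammaJet N (e' j) (N - 1 - i + j) (cutThreshold t k s j))
      (A' := Matrix.of fun i j : Fin N =>
        gammaJet N (e' j) (N - 1 - i + j + 1) (cutThreshold t k s j) *
          (if (j < k ∧ s < t j) ∨ j = k then 1 else 0))
      (fun i j => (hasDerivAt_gammaJet _ _ _ _).comp_hasDerivWithinAt s
        (hasDerivWithinAt_cutThreshold t k s j))
    have hsum : ∑ j, ((Matrix.of fun i j : Fin N =>
        gammaJet N (e' j) (N - 1 - i + j) (cutThreshold t k s j)).updateCol j fun i =>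
          gammaJet N (e' j) (N - 1 - i + j + 1) (cutThreshold t k s j) *
          (if (j < k ∧ s < t j) ∨ j = k then 1 else 0)).det =
        jointDet N e (cutThreshold t k s) - jointDet N e' (cutThreshold t k s) := by
      rw [Finset.sum_eq_single k]
      · have hcol : (fun i : Fin N => gammaJet N (e' k) (N - 1 - i + k + 1) (cutThreshold t k s k) *
            (if (k < k ∧ s < t k) ∨ k = k then (1 : ℝ) else 0)) =
            (fun i : Fin N => gammaJet N (e k) (N - 1 - i + k) (cutThreshold t k s k)) +
            (-1 : ℝ) • (fun i : Fin N =>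
              gammaJet N (e' k) (N - 1 - i + k) (cutThreshold t k s k)) := by
          funext i
          simp [he' k le_rfl, hk, gammaJet_succ_succ]
          ring
        rw [hcol, Matrix.det_updateCol_add, Matrix.det_updateCol_smul, neg_one_mul,
          ← sub_eq_add_neg]
        congr 1
        · unfold jointDet
          congr 1
          ext i j
          by_cases hj : j = k
          · subst hj
            simp
          · rw [Matrix.updateCol_ne hj, Matrix.of_apply, Matrix.of_apply]
            rcases lt_or_gt_of_ne hj with h | h
            · rw [he' j h.le, hel j h]
            · rw [hee j h]
        · unfold jointDet
          congr 1
          ext i j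
          by_cases hj : j = k
          · subst hj
            simp
          · rw [Matrix.updateCol_ne hj]
      · intro j _ hj
        by_cases h : j < k ∧ s < t j
        · have hj1 : (j : ℕ) + 1 < N := by
            have := Fin.lt_def.1 h.1
            omega
          have hle : (⟨j + 1, hj1⟩ : Fin N) ≤ k := Fin.le_def.2 (Fin.lt_def.1 h.1)
          have c1 : cutThreshold t k s j = s := by
            simp [cutThreshold, h.1, min_eq_right h.2.le]
          have c2 : cutThreshold t k s ⟨j + 1, hj1⟩ = s := by
            unfold cutThreshold
            split_ifs with h5 h6
            · exact min_eq_right (h.2.le.trans (ht (Fin.le_def.2 (Nat.le_succ _))))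
            · rfl
            · exact absurd (lt_of_le_of_ne hle h6) h5
          refine Matrix.det_zero_of_column_eq (i := j) (j := ⟨j + 1, hj1⟩) ?_ fun i => ?_
          · intro h7
            have := congrArg Fin.val h7
            simp at this
          · rw [Matrix.updateCol_self, Matrix.updateCol_ne, Matrix.of_apply, c1, c2, he' _ hle,
              he' j h.1.le]
            · simp [h, add_assoc]
            · intro h7
              have := congrArg Fin.val h7
              simp at this
        · refine Matrix.det_eq_zero_of_column_eq_zero j fun i => ?_
          rw [Matrix.updateCol_self]
          simp [h, hj]
      · simp
    have hdet' : HasDerivWithinAt (fun s => jointDet N e' (cutThreshold t k s))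
        (jointDet N e (cutThreshold t k s) - jointDet N e' (cutThreshold t k s))
        (Set.Ioi s) s := by
      rw [← hsum]
      exact hdet
    refine ((Real.hasDerivAt_exp s).hasDerivWithinAt.mul hdet').congr_deriv ?_
    ring
  have := intervalIntegral.integral_eq_sub_of_hasDeriv_right (a := 0) (b := t k)
    hcont'.continuousOn (fun x _ => hderiv x) (hcont.intervalIntegrable _ _)
  rw [this, hzero, cutThreshold_self ht]
  ring

lemma jointDet_zero {N : ℕ} (t : Fin N → ℝ) : jointDet N (fun _ => 0) t = 1 := by
  unfold jointDet
  rw [Matrix.det_of_isLowerTriangular]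
  · refine Finset.prod_eq_one fun i _ => ?_
    have h1 : N - 1 - (i : ℕ) + i = N - 1 := by omega
    simp [gammaJet, h1, i.pos]
  · intro i j hij
    have hij : i < j := hij
    have h1 : ¬ (N - 1 - (i : ℕ) + j < N) := by
      have := Fin.lt_def.1 hij
      omega
    simp [gammaJet, h1]

end Determinant

section JointLaw

open ProbabilityTheory

lemma lintegral_expMeasure_one {f : ℝ → ENNReal} (hf : Measurable f) :
    ∫⁻ r, f r ∂(expMeasure 1) = ∫⁻ r in Set.Ici 0, ENNReal.ofReal (Real.exp (-r)) * f r := by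
  have h : expMeasure 1 = volume.withDensity (exponentialPDF 1) := rfl
  have hm : Measurable (exponentialPDF 1) :=
    (measurable_exponentialPDFReal 1).ennreal_ofReal
  rw [h, lintegral_withDensity_eq_lintegral_mul _ hm hf, ← lintegral_indicator measurableSet_Ici]
  refine lintegral_congr fun r => ?_
  by_cases hr : 0 ≤ r
  · simp [exponentialPDF_eq, hr]
  · simp [exponentialPDF_eq, hr]

variable {Ω : Type*} [MeasurableSpace Ω] {μ : Measure Ω} {v : ℕ × ℕ → Ω → ℝ}

/-- The passage times of one column when the first `k` sites of row `m + 1` have been added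
to the first `m` rows. -/
noncomputable def columnTimes (N m k : ℕ) (w : ℕ × ℕ → ℝ) (i : Fin N) : ℝ :=
  lastPassage w (if (i : ℕ) < k then m + 1 else m) (i + 1)

lemma columnTimes_step_iff {N m : ℕ} {w : ℕ × ℕ → ℝ} (hw : ∀ p, 0 ≤ w p) (k : Fin N)
    {t : Fin N → ℝ} :
    (∀ i, columnTimes N m (k + 1) w i ≤ t i) ↔
      w (m + 1, k + 1) ≤ t k ∧
        ∀ i, columnTimes N m k w i ≤ cutThreshold t k (t k - w (m + 1, k + 1)) i := by
  have hk0 := lastPassage_nonneg hw m (k + 1)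
  constructor
  · intro h
    have hk := h k
    simp only [columnTimes, Nat.lt_succ_self, if_true, lastPassage_succ] at hk
    have h1 := le_max_left (lastPassage w m (k + 1)) (lastPassage w (m + 1) k)
    have h2 := le_max_right (lastPassage w m (k + 1)) (lastPassage w (m + 1) k)
    refine ⟨by linarith, fun i => ?_⟩
    unfold cutThreshold
    split_ifs with h3 h4
    · have h5 : (i : ℕ) < k := h3
      have h6 := h i
      simp only [columnTimes, h5, h5.trans (Nat.lt_succ_self _), if_true] at h6 ⊢
      have h7 := lastPassage_mono hw (le_refl (m + 1)) (Nat.succ_le_of_lt h5)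
      exact le_min h6 (by simp only [Nat.succ_eq_add_one] at h7; linarith)
    · subst h4
      simp only [columnTimes, lt_self_iff_false, if_false]
      linarith
    · have h5 : ¬ (i : ℕ) < k := h3
      have h6 : ¬ (i : ℕ) < k + 1 := by
        have : (i : ℕ) ≠ k := fun h => h4 (Fin.ext h)
        omega
      have h7 := h i
      simpa only [columnTimes, h5, h6, if_false] using h7
  · rintro ⟨h0, h⟩ i
    rcases lt_trichotomy i k with h1 | h1 | h1
    · have h2 : (i : ℕ) < k := h1
      have h3 := h i
      simp only [columnTimes, cutThreshold, h1, h2, h2.trans (Nat.lt_succ_self _), if_true] at h3 ⊢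
      exact h3.trans (min_le_left _ _)
    · subst h1
      have h3 := h i
      simp only [columnTimes, cutThreshold, lt_self_iff_false, if_false, if_true] at h3
      simp only [columnTimes, Nat.lt_succ_self, if_true, lastPassage_succ]
      have h4 : lastPassage w (m + 1) i ≤ t i - w (m + 1, i + 1) := by
        rcases Nat.eq_zero_or_pos (i : ℕ) with h5 | h5
        · rw [h5] at h0 ⊢
          simpa using h0
        · have h6 : (i : ℕ) - 1 < N := by omega
          have h7 : (⟨i - 1, h6⟩ : Fin N) < i := Fin.lt_def.2 (by simp only []; omega)
          have h8 : (i : ℕ) - 1 < i := h7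
          have h9 := h ⟨i - 1, h6⟩
          simp only [columnTimes, cutThreshold, h7, h8, if_true,
            Nat.sub_add_cancel h5] at h9
          exact h9.trans (min_le_right _ _)
      linarith [max_le h3 h4]
    · have h2 : ¬ (i : ℕ) < k := not_lt.2 (le_of_lt h1)
      have h2' : (k : ℕ) < i := h1
      have h3 : ¬ (i : ℕ) < k + 1 := by omega
      have h4 := h i
      simp only [columnTimes, cutThreshold, h2, h3, not_lt.2 h1.le, h1.ne', if_false] at h4 ⊢
      exact h4

lemma IsExpWeights.measure_columnTimes_step [IsProbabilityMeasure μ] (hv : IsExpWeights μ v)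
    {N m : ℕ} (k : Fin N)
    (ih : ∀ t : Fin N → ℝ, Monotone t → (∀ i, 0 ≤ t i) →
      μ.real {ω | ∀ i, columnTimes N m k (fun p => v p ω) i ≤ t i} =
        jointDet N (fun j => if (j : ℕ) < k then m + 1 else m) t)
    {t : Fin N → ℝ} (ht : Monotone t) (ht0 : ∀ i, 0 ≤ t i) :
    μ.real {ω | ∀ i, columnTimes N m (k + 1) (fun p => v p ω) i ≤ t i} =
      jointDet N (fun j => if (j : ℕ) < k + 1 then m + 1 else m) t := by
  set e : Fin N → ℕ := fun j => if (j : ℕ) < k then m + 1 else m with he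
  set X : Ω → Fin N → ℝ := fun ω => columnTimes N m k (fun p => v p ω) with hX
  set V : Ω → ℝ := v (m + 1, k + 1) with hV
  set S : Set (ℕ × ℕ) := {p | p ≠ (m + 1, (k : ℕ) + 1)} with hS
  have hXm : Measurable[weightSigma v S] X := by
    refine @measurable_pi_lambda _ _ _ (weightSigma v S) _ X fun i => ?_
    refine measurable_lastPassage_of_le fun p h1 h2 => measurable_weightSigma v ?_
    rintro rfl
    simp only at h1 h2
    split_ifs at h1 with h3 <;> omega
  have hVm : Measurable[weightSigma v Sᶜ] V :=
    measurable_weightSigma v (by simp [hS])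
  have hind : IndepFun X V μ := hv.indepFun disjoint_compl_right hXm hVm
  have hXm' : Measurable X := by
    refine measurable_pi_lambda _ fun i => ?_
    exact hv.measurable_lastPassage _ _
  have hVm' : Measurable V := hv.measurable _
  set B : Set ((Fin N → ℝ) × ℝ) :=
    {q | q.2 ≤ t k ∧ ∀ i, q.1 i ≤ cutThreshold t k (t k - q.2) i} with hB
  have hBm : MeasurableSet B := by
    have hc : Continuous fun q : (Fin N → ℝ) × ℝ => cutThreshold t k (t k - q.2) :=
      (continuous_cutThreshold t k).comp (by fun_prop)
    have h1 : B = {q | q.2 ≤ t k} ∩ ⋂ i, {q | q.1 i ≤ cutThreshold t k (t k - q.2) i} := by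
      ext q
      simp [hB]
    rw [h1]
    refine (measurableSet_le measurable_snd measurable_const).inter
      (MeasurableSet.iInter fun i => measurableSet_le ?_ ?_)
    · exact (measurable_pi_apply i).comp measurable_fst
    · exact ((continuous_apply i).comp hc).measurable
  have hevent : {ω | ∀ i, columnTimes N m (k + 1) (fun p => v p ω) i ≤ t i} =
      (fun ω => (X ω, V ω)) ⁻¹' B := by
    ext ω
    exact columnTimes_step_iff (fun p => hv.nonneg p ω) k
  have hprod := (indepFun_iff_map_prod_eq_prod_map_map hXm'.aemeasurable hVm'.aemeasurable).1 hind
  have hXprob := Measure.isProbabilityMeasure_map (μ := μ) hXm'.aemeasurable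
  have hVprob := isProbabilityMeasure_expMeasure one_pos
  have hf : ∀ r ∈ Set.Icc 0 (t k),
      0 ≤ jointDet N e (cutThreshold t k (t k - r)) ∧
      μ.map X ((fun x => (x, r)) ⁻¹' B) =
        ENNReal.ofReal (jointDet N e (cutThreshold t k (t k - r))) := by
    intro r hr
    rw [← ih _ (cutThreshold_monotone ht (by linarith [hr.1]))
      (cutThreshold_nonneg ht0 k (by linarith [hr.2]))]
    refine ⟨measureReal_nonneg, ?_⟩
    rw [ofReal_measureReal, Measure.map_apply hXm' (hBm.preimage measurable_prodMk_right)]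
    congr 1
    ext ω
    simp [hB, hX, hr.2]
  have hmain : μ {ω | ∀ i, columnTimes N m (k + 1) (fun p => v p ω) i ≤ t i} =
      ENNReal.ofReal (∫ r in (0 : ℝ)..t k,
        Real.exp (-r) * jointDet N e (cutThreshold t k (t k - r))) := by
    have hg : Continuous fun r => Real.exp (-r) * jointDet N e (cutThreshold t k (t k - r)) := by
      refine (by fun_prop : Continuous fun r : ℝ => Real.exp (-r)).mul ?_
      exact (continuous_jointDet N e).comp ((continuous_cutThreshold t k).comp (by fun_prop))
    rw [hevent, ← Measure.map_apply (hXm'.prodMk hVm') hBm, hprod, hv.map_eq,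
      Measure.prod_apply_symm hBm,
      lintegral_expMeasure_one (measurable_measure_prodMk_right hBm),
      intervalIntegral.integral_of_le (ht0 k), ← integral_Icc_eq_integral_Ioc,
      ofReal_integral_eq_lintegral_ofReal (hg.integrableOn_Icc) ?_]
    · rw [← lintegral_indicator measurableSet_Ici, ← lintegral_indicator measurableSet_Icc]
      refine lintegral_congr fun r => ?_
      by_cases h0 : 0 ≤ r
      · by_cases h1 : r ≤ t k
        · rw [Set.indicator_of_mem (show r ∈ Set.Ici 0 from h0),
            Set.indicator_of_mem (show r ∈ Set.Icc 0 (t k) from ⟨h0, h1⟩), (hf r ⟨h0, h1⟩).2,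
            ENNReal.ofReal_mul (Real.exp_pos _).le]
        · rw [Set.indicator_of_mem (show r ∈ Set.Ici 0 from h0),
            Set.indicator_of_notMem (fun h => h1 h.2)]
          have : (fun x => (x, r)) ⁻¹' B = ∅ := by
            ext x
            simp [hB, h1]
          rw [this, measure_empty, mul_zero]
      · rw [Set.indicator_of_notMem (show r ∉ Set.Ici 0 from h0),
          Set.indicator_of_notMem (fun h => h0 h.1)]
    · refine (ae_restrict_iff' measurableSet_Icc).2 (Eventually.of_forall fun r hr => ?_)
      exact mul_nonneg (Real.exp_pos _).le (hf r hr).1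
  have hint : ∫ r in (0 : ℝ)..t k, Real.exp (-r) * jointDet N e (cutThreshold t k (t k - r)) =
      jointDet N (fun j => if (j : ℕ) < k + 1 then m + 1 else m) t := by
    have h1 := intervalIntegral.integral_comp_sub_left (a := 0) (b := t k)
      (fun s => Real.exp (-(t k)) * (Real.exp s * jointDet N e (cutThreshold t k s))) (t k)
    simp only [sub_self, sub_zero] at h1
    have h2 : ∀ r, Real.exp (-r) * jointDet N e (cutThreshold t k (t k - r)) =
        Real.exp (-(t k)) *
          (Real.exp (t k - r) * jointDet N e (cutThreshold t k (t k - r))) := by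
      intro r
      rw [← mul_assoc, ← Real.exp_add]
      ring_nf
    simp only [h2]
    rw [h1, intervalIntegral.integral_const_mul,
      jointDet_step (m := m) (e' := fun j => if (j : ℕ) < k + 1 then m + 1 else m)
        (by simp [he]) (fun i hi => ?_) (fun i hi => ?_) (fun i hi => ?_) ht ht0,
      ← mul_assoc, ← Real.exp_add, neg_add_cancel, Real.exp_zero, one_mul]
    · rw [if_pos (Nat.lt_succ_of_le hi)]
    · have h3 : (k : ℕ) < i := hi
      rw [he]
      simp only []
      rw [if_neg (by omega), if_neg (by omega)]
    · exact if_pos hi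
  have hnn : 0 ≤ ∫ r in (0 : ℝ)..t k,
      Real.exp (-r) * jointDet N e (cutThreshold t k (t k - r)) :=
    intervalIntegral.integral_nonneg (ht0 k) fun r hr =>
      mul_nonneg (Real.exp_pos _).le (hf r hr).1
  rw [Measure.real, hmain, ENNReal.toReal_ofReal hnn, hint]

lemma IsExpWeights.measure_columnTimes [IsProbabilityMeasure μ] (hv : IsExpWeights μ v)
    (N m k : ℕ) (hk : k ≤ N) (t : Fin N → ℝ) (ht : Monotone t) (ht0 : ∀ i, 0 ≤ t i) :
    μ.real {ω | ∀ i, columnTimes N m k (fun p => v p ω) i ≤ t i} =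
      jointDet N (fun j => if (j : ℕ) < k then m + 1 else m) t := by
  induction m generalizing k t with
  | zero =>
    induction k generalizing t with
    | zero =>
      simp [columnTimes, ht0, jointDet_zero]
    | succ k ihk =>
      exact hv.measure_columnTimes_step (⟨k, hk⟩ : Fin N) (fun t => ihk (by omega) t) ht ht0
  | succ m ihm =>
    induction k generalizing t with
    | zero =>
      have := ihm N le_rfl t ht ht0
      simpa [columnTimes] using this
    | succ k ihk =>
      exact hv.measure_columnTimes_step (⟨k, hk⟩ : Fin N) (fun t => ihk (by omega) t) ht ht0

lemma IsExpWeights.measure_lastPassage_le [IsProbabilityMeasure μ] (hv : IsExpWeights μ v)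
    (M : ℕ) {N : ℕ} (hN : 1 ≤ N) {t : ℝ} (ht : 0 ≤ t) :
    μ.real {ω | lastPassage (fun p => v p ω) M N ≤ t} =
      jointDet N (fun _ => M) fun _ => t := by
  have h := hv.measure_columnTimes N M 0 (Nat.zero_le _) (fun _ => t) monotone_const
    (fun _ => ht)
  simp only [Nat.not_lt_zero, if_false] at h
  rw [← h]
  congr 1
  ext ω
  simp only [Set.mem_ofPred_eq, columnTimes, Nat.not_lt_zero, if_false]
  constructor
  · intro h i
    exact (lastPassage_mono (fun p => hv.nonneg p ω) le_rfl i.isLt).trans h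
  · intro h
    have := h ⟨N - 1, by omega⟩
    simpa only [Nat.sub_add_cancel hN] using this

end JointLaw

section CoulombGas

open scoped Pointwise

lemma sum_choose_mul_gammaJet (N m k j : ℕ) (t : ℝ) :
    ∑ l ∈ Finset.range (j + 1), (j.choose l : ℝ) * gammaJet N (m + j) (k + l) t =
      gammaJet N m k t := by
  induction j with
  | zero => simp
  | succ j ih =>
    have h := Finset.sum_choose_succ_mul (R := ℝ)
      (fun i _ => gammaJet N (m + (j + 1)) (k + i) t) j
    rw [show j + 1 + 1 = j + 2 from rfl, h, ← ih, ← Finset.sum_add_distrib]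
    refine Finset.sum_congr rfl fun l _ => ?_
    rw [← mul_add, ← add_assoc k l 1, ← add_assoc m j 1, gammaJet_succ_succ]
    ring

lemma jointDet_const_eq_det {N M : ℕ} (hM : N ≤ M) (t : ℝ) :
    jointDet N (fun _ => M) (fun _ => t) =
      (Matrix.of fun i j : Fin N => gammaJet N (M - j) (N - 1 - i) t).det := by
  set U : Matrix (Fin N) (Fin N) ℝ := Matrix.of fun l j => ((j : ℕ).choose l : ℝ) with hU
  have hUdet : U.det = 1 := by
    rw [Matrix.det_of_isUpperTriangular]
    · simp [hU]
    · intro i j hij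
      simp only [hU, Matrix.of_apply, Nat.cast_eq_zero]
      exact Nat.choose_eq_zero_of_lt hij
  rw [jointDet, ← mul_one (Matrix.det _), ← hUdet, ← Matrix.det_mul]
  congr 1
  ext i j
  simp only [Matrix.mul_apply, Matrix.of_apply, hU]
  have hj : (j : ℕ) < N := j.isLt
  rw [← sum_choose_mul_gammaJet N (M - j) (N - 1 - i) j t, Nat.sub_add_cancel (by omega),
    Fin.sum_univ_eq_sum_range
      (fun l => gammaJet N M (N - 1 - i + l) t * ((j : ℕ).choose l : ℝ)) N]
  symm
  refine Finset.sum_subset_zero_on_sdiff ?_ (fun l hl => ?_) fun l _ => mul_comm _ _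
  · intro l hl
    simp only [Finset.mem_range] at hl ⊢
    omega
  · simp only [Finset.mem_sdiff, Finset.mem_range] at hl
    rw [Nat.choose_eq_zero_of_lt (by omega)]
    simp

lemma gammaJet_self {N : ℕ} (hN : 1 ≤ N) (m : ℕ) (x : ℝ) :
    gammaJet N (m + 1) N x = x ^ m * Real.exp (-x) / m.factorial := by
  have hstep : ∀ (m : ℕ) (g : ℝ → ℝ), (∀ x, HasDerivAt g (Real.exp x * gammaJet N m N x) x) →
      g 0 = gammaJet N (m + 1) N 0 → ∀ x, Real.exp x * gammaJet N (m + 1) N x = g x := by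
    intro m g hg h0 x
    have hd : ∀ x, HasDerivAt (fun x => Real.exp x * gammaJet N (m + 1) N x - g x) 0 x := by
      intro x
      refine (((Real.hasDerivAt_exp x).mul (hasDerivAt_gammaJet N (m + 1) N x)).sub
        (hg x)).congr_deriv ?_
      rw [gammaJet_succ_succ]
      ring
    have := is_const_of_deriv_eq_zero (fun x => (hd x).differentiableAt)
      (fun x => (hd x).deriv) x 0
    simp only [Real.exp_zero, h0] at this
    linarith
  have hfin : ∀ x y z : ℝ, Real.exp x * y = z → y = z * Real.exp (-x) := by
    rintro x y z rfl
    rw [mul_right_comm, ← Real.exp_add]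
    simp
  obtain ⟨n, rfl⟩ := Nat.exists_eq_add_of_le' hN
  induction m generalizing x with
  | zero =>
    have h := hstep 0 (fun _ => 1) (fun x => (hasDerivAt_const x 1).congr_deriv (by
      simp [gammaJet])) ?_ x
    · simpa using hfin _ _ _ h
    · rw [gammaJet_succ_succ, gammaJet_succ_zero 0 (Nat.lt_succ_self n)]
      simp [gammaJet]
  | succ m ih =>
    have h := hstep (m + 1) (fun x => x ^ (m + 1) / (m + 1).factorial) (fun x =>
      ((hasDerivAt_pow (m + 1) x).div_const _).congr_deriv ?_) ?_ x
    · rw [hfin _ _ _ h]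
      ring
    · rw [ih x, Nat.factorial_succ, Real.exp_neg]
      push_cast
      have := Real.exp_ne_zero x
      field_simp
    · rw [gammaJet_succ_succ, gammaJet_succ_zero (m + 1) (Nat.lt_succ_self n),
        gammaJet_succ_zero m (Nat.lt_succ_self n)]
      simp

lemma integral_pow_mul_gammaJet {N : ℕ} (m k i : ℕ) (hk : k + i < N) (t : ℝ) :
    ∫ x in (0 : ℝ)..t, (t - x) ^ i / i.factorial * gammaJet N (m + 1) (k + i + 1) x =
      gammaJet N (m + 1) k t := by
  induction i with
  | zero =>
    simp only [pow_zero, Nat.factorial_zero, Nat.cast_one, div_one, one_mul, add_zero]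
    rw [intervalIntegral.integral_eq_sub_of_hasDerivAt
      (fun x _ => hasDerivAt_gammaJet N (m + 1) k x)
      ((continuous_gammaJet _ _ _).intervalIntegrable _ _),
      gammaJet_succ_zero m (by omega), sub_zero]
  | succ i ih =>
    rw [← ih (by omega)]
    have hu : ∀ x : ℝ, HasDerivAt (fun x => (t - x) ^ (i + 1) / ((i + 1).factorial : ℝ))
        (-((t - x) ^ i / i.factorial)) x := by
      intro x
      refine ((((hasDerivAt_id x).const_sub t).pow (i + 1)).div_const _).congr_deriv ?_
      rw [Nat.factorial_succ]
      push_cast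
      simp only [id]
      field_simp
    rw [intervalIntegral.integral_mul_deriv_eq_deriv_mul (fun x _ => hu x)
      (fun x _ => hasDerivAt_gammaJet N (m + 1) (k + (i + 1)) x)
      (Continuous.intervalIntegrable (by fun_prop) _ _)
      ((continuous_gammaJet _ _ _).intervalIntegrable _ _),
      gammaJet_succ_zero m hk]
    simp only [sub_self, ne_eq, Nat.succ_ne_zero, not_false_eq_true, zero_pow, zero_div, zero_mul,
      mul_zero, neg_mul, zero_sub, intervalIntegral.integral_neg, neg_neg, add_assoc]

/-- Andréief's identity. -/
lemma integral_det_mul_det {α : Type*} [MeasurableSpace α] {ν : Measure α} [SigmaFinite ν]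
    {n : Type*} [Fintype n] [DecidableEq n] (a b : n → α → ℝ)
    (hab : ∀ i j, Integrable (fun x => a i x * b j x) ν) :
    ∫ x : n → α, (Matrix.of fun i l => a i (x l)).det * (Matrix.of fun j l => b j (x l)).det
        ∂(Measure.pi fun _ => ν) =
      (Fintype.card n).factorial * (Matrix.of fun i j => ∫ x, a i x * b j x ∂ν).det := by
  set I : Matrix n n ℝ := Matrix.of fun i j => ∫ x, a i x * b j x ∂ν with hI
  have hexp : ∀ x : n → α, (Matrix.of fun i l => a i (x l)).det *
      (Matrix.of fun j l => b j (x l)).det =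
      ∑ τ : Equiv.Perm n, ∑ σ : Equiv.Perm n, ((Equiv.Perm.sign τ : ℤ) : ℝ) *
        (((Equiv.Perm.sign σ : ℤ) : ℝ) * ∏ l, (a (σ l) (x l) * b (τ l) (x l))) := by
    intro x
    simp only [Matrix.det_apply', Matrix.of_apply]
    rw [Finset.sum_mul_sum, Finset.sum_comm]
    refine Finset.sum_congr rfl fun τ _ => Finset.sum_congr rfl fun σ _ => ?_
    rw [Finset.prod_mul_distrib]
    ring
  have hint : ∀ τ σ : Equiv.Perm n, Integrable
      (fun x : n → α => ∏ l, (a (σ l) (x l) * b (τ l) (x l))) (Measure.pi fun _ => ν) :=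
    fun τ σ => Integrable.fintype_prod (f := fun l y => a (σ l) y * b (τ l) y)
      fun l => hab _ _
  simp only [hexp]
  rw [integral_finsetSum _ fun τ _ => integrable_finsetSum _ fun σ _ =>
    ((hint τ σ).const_mul _).const_mul _]
  have h2 : ∀ τ : Equiv.Perm n, ∫ x : n → α, ∑ σ : Equiv.Perm n, ((Equiv.Perm.sign τ : ℤ) : ℝ) *
        (((Equiv.Perm.sign σ : ℤ) : ℝ) * ∏ l, (a (σ l) (x l) * b (τ l) (x l)))
        ∂(Measure.pi fun _ => ν) = I.det := by
    intro τ
    rw [integral_finsetSum _ fun σ _ => ((hint τ σ).const_mul _).const_mul _]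
    simp only [integral_const_mul]
    rw [← Finset.mul_sum]
    have h3 : ∑ σ : Equiv.Perm n, ((Equiv.Perm.sign σ : ℤ) : ℝ) *
        ∫ x : n → α, ∏ l, (a (σ l) (x l) * b (τ l) (x l)) ∂(Measure.pi fun _ => ν) =
        (I.submatrix id τ).det := by
      rw [Matrix.det_apply']
      refine Finset.sum_congr rfl fun σ _ => ?_
      rw [integral_fintype_prod_eq_prod (fun l y => a (σ l) y * b (τ l) y)]
      rfl
    rw [h3, Matrix.det_permute', ← mul_assoc, ← Int.cast_mul]
    simp
  simp only [h2]
  rw [Finset.sum_const, Finset.card_univ, Fintype.card_perm, nsmul_eq_mul]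

/-- The joint density, up to normalisation, of a Laguerre-type ensemble. -/
noncomputable def coulombDensity (N : ℕ) (a b : ℝ) (x : Fin N → ℝ) : ℝ :=
  (∏ i, ∏ j ∈ {i}ᶜ, |x i - x j|) * ∏ i, (x i ^ a * Real.exp (-(b * x i)))

/-- The unnormalised probability that all particles lie in `[0,c]`. -/
noncomputable def coulombIntegral (N : ℕ) (a b c : ℝ) : ℝ :=
  ∫ x in Set.pi Set.univ fun _ : Fin N => Set.Icc 0 c, coulombDensity N a b x

lemma prod_Ioi_sub_mul_self {N : ℕ} (x : Fin N → ℝ) :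
    (∏ i, ∏ j ∈ Finset.Ioi i, (x i - x j)) * (∏ i, ∏ j ∈ Finset.Ioi i, (x i - x j)) =
      ∏ i, ∏ j ∈ {i}ᶜ, |x i - x j| := by
  rw [← abs_mul_abs_self, Finset.abs_prod]
  simp only [Finset.abs_prod]
  rw [← Finset.prod_mul_distrib]
  simp only [← Finset.prod_mul_distrib]
  have h := Finset.prod_prod_Ioi_mul_eq_prod_prod_off_diag
    (fun i j : Fin N => |x i - x j|)
  have h' : ∀ i j, |x j - x i| = |x i - x j| := fun i j => abs_sub_comm _ _
  simp only [h'] at h ⊢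
  exact h

lemma exists_jointDet_eq_coulombIntegral {N M : ℕ} (hN : 1 ≤ N) (hM : N ≤ M) :
    ∃ C : ℝ, 0 < C ∧ ∀ t : ℝ, 0 ≤ t →
      jointDet N (fun _ => M) (fun _ => t) = C * coulombIntegral N (M - N : ℕ) 1 t := by
  refine ⟨((N.factorial : ℝ))⁻¹ * ((∏ i : Fin N, (((i : ℕ).factorial : ℝ))⁻¹) *
    ∏ j : Fin N, (((M - 1 - j).factorial : ℝ))⁻¹), by positivity, fun t ht => ?_⟩
  set a : Fin N → ℝ → ℝ := fun i x => (t - x) ^ (i : ℕ) / (i : ℕ).factorial with ha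
  set b : Fin N → ℝ → ℝ := fun j x =>
    x ^ (M - 1 - j) * Real.exp (-x) / (M - 1 - j).factorial with hb
  have hac : ∀ i, Continuous (a i) := fun i => by fun_prop
  have hbc : ∀ i, Continuous (b i) := fun i => by fun_prop
  have hA := integral_det_mul_det (ν := volume.restrict (Set.Icc 0 t)) a b
    fun i j => ((hac i).mul (hbc j)).integrableOn_Icc
  rw [Fintype.card_fin] at hA
  have hdet : (Matrix.of fun i j => ∫ x in Set.Icc 0 t, a i x * b j x).det =
      jointDet N (fun _ => M) (fun _ => t) := by
    rw [jointDet_const_eq_det hM]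
    congr 1
    ext i j
    have hi := i.isLt
    have hj := j.isLt
    simp only [Matrix.of_apply]
    rw [integral_Icc_eq_integral_Ioc, ← intervalIntegral.integral_of_le ht,
      show M - (j : ℕ) = (M - 1 - j) + 1 by omega,
      ← integral_pow_mul_gammaJet (M - 1 - j) (N - 1 - i) i (by omega) t,
      show N - 1 - (i : ℕ) + i + 1 = N by omega]
    simp only [gammaJet_self hN, ha, hb]
  rw [hdet] at hA
  have hfac : (N.factorial : ℝ) ≠ 0 := by positivity
  rw [eq_comm, ← eq_inv_mul_iff_mul_eq₀ hfac] at hA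
  rw [hA, mul_assoc]
  congr 1
  rw [coulombIntegral, volume_pi, Measure.restrict_pi_pi, ← integral_const_mul]
  refine integral_congr_ae (Eventually.of_forall fun x => ?_)
  simp only []
  have hdeta : (Matrix.of fun i l => a i (x l)).det =
      (∏ i : Fin N, (((i : ℕ).factorial : ℝ))⁻¹) * ∏ i, ∏ j ∈ Finset.Ioi i, (x i - x j) := by
    have h1 := Matrix.det_vandermonde fun l => t - x l
    simp only [sub_sub_sub_cancel_left] at h1
    rw [← h1, ← Matrix.det_transpose (Matrix.vandermonde _), ← Matrix.det_mul_column]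
    congr 1
    ext i l
    simp [ha, Matrix.vandermonde, div_eq_inv_mul]
  have hdetb : (Matrix.of fun j l => b j (x l)).det =
      (∏ j : Fin N, (((M - 1 - j).factorial : ℝ))⁻¹) *
        ((∏ l, (x l ^ (M - N) * Real.exp (-(1 * x l)))) *
          ∏ i, ∏ j ∈ Finset.Ioi i, (x i - x j)) := by
    have h1 := Matrix.det_projVandermonde (fun _ => 1) x
    simp only [one_mul] at h1
    rw [← h1, ← Matrix.det_transpose (Matrix.projVandermonde _ _), ← Matrix.det_mul_row,
      ← Matrix.det_mul_column]
    congr 1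
    ext j l
    have hj := j.isLt
    have e : x l ^ (M - 1 - j) = x l ^ (M - N) * x l ^ (N - (j + 1)) := by
      rw [← pow_add]
      congr 1
      omega
    simp only [hb, Matrix.of_apply, Matrix.transpose_apply, Matrix.projVandermonde_apply,
      Fin.val_rev, e, one_pow, one_mul, div_eq_inv_mul]
    ring
  simp only [coulombDensity, Real.rpow_natCast]
  rw [hdeta, hdetb, ← prod_Ioi_sub_mul_self]
  ring

lemma coulombIntegral_scale {N a : ℕ} (hN : 1 ≤ N) (c : ℝ) :
    coulombIntegral N a 1 (N * c) =
      ((N : ℝ) ^ N * ((N : ℝ) ^ (N * (N - 1)) * (N : ℝ) ^ (a * N))) *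
        coulombIntegral N a N c := by
  have hN0 : (0 : ℝ) < N := by exact_mod_cast hN
  have h := Measure.setIntegral_comp_smul_of_pos (volume : Measure (Fin N → ℝ))
    (coulombDensity N a 1) (Set.pi Set.univ fun _ : Fin N => Set.Icc 0 c) hN0
  have hset : (N : ℝ) • (Set.pi Set.univ fun _ : Fin N => Set.Icc 0 c) =
      Set.pi Set.univ fun _ : Fin N => Set.Icc (0 : ℝ) (N * c) := by
    ext x
    rw [Set.mem_smul_set_iff_inv_smul_mem₀ hN0.ne']
    simp only [Set.mem_pi, Set.mem_univ, true_imp_iff, Set.mem_Icc, Pi.smul_apply, smul_eq_mul]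
    refine forall_congr' fun i => ?_
    rw [inv_mul_le_iff₀ hN0, mul_nonneg_iff_of_pos_left (inv_pos.2 hN0)]
  rw [hset, Module.finrank_fin_fun, smul_eq_mul] at h
  have hd : ∀ x : Fin N → ℝ, coulombDensity N a 1 ((N : ℝ) • x) =
      ((N : ℝ) ^ (N * (N - 1)) * (N : ℝ) ^ (a * N)) * coulombDensity N a N x := by
    intro x
    have h1 : ∀ i j, |(N : ℝ) * x i - N * x j| = N * |x i - x j| := by
      intro i j
      rw [← mul_sub, abs_mul, abs_of_pos hN0]
    simp only [coulombDensity, Real.rpow_natCast, Pi.smul_apply, smul_eq_mul, h1,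
      Finset.prod_mul_distrib,
      Finset.prod_const, mul_pow, one_mul, Finset.card_compl, Finset.card_singleton,
      Finset.card_univ, Fintype.card_fin, ← pow_mul]
    ring
  simp only [hd, integral_const_mul] at h
  have hNN : ((N : ℝ) ^ N) ≠ 0 := by positivity
  rw [coulombIntegral, coulombIntegral, mul_assoc, h, mul_inv_cancel_left₀ hNN]

end CoulombGas

section CoulombMaximum

lemma prod_compl_singleton_eq {N : ℕ} (i : Fin N) (f : Fin N → ℝ) :
    ∏ j ∈ {i}ᶜ, f j = ∏ j, if i = j then 1 else f j := by
  rw [← Finset.prod_subset (Finset.subset_univ ({i}ᶜ : Finset (Fin N)))]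
  · refine Finset.prod_congr rfl fun j hj => ?_
    rw [if_neg fun h => (Finset.mem_compl.1 hj) (by simp [h])]
  · intro j _ hj
    rw [if_pos]
    simpa [eq_comm] using hj

lemma coulombDensity_comp_perm {N : ℕ} (a b : ℝ) (x : Fin N → ℝ) (σ : Equiv.Perm (Fin N)) :
    coulombDensity N a b (x ∘ σ) = coulombDensity N a b x := by
  simp only [coulombDensity, prod_compl_singleton_eq, Function.comp_apply]
  rw [Equiv.prod_comp σ fun i => x i ^ a * Real.exp (-(b * x i)),
    ← Equiv.prod_comp σ fun i => ∏ j, if i = j then 1 else |x i - x j|]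
  congr 1
  refine Finset.prod_congr rfl fun i _ => ?_
  rw [← Equiv.prod_comp σ fun j => if σ i = j then 1 else |x (σ i) - x j|]
  simp

lemma coulombDensity_nonneg {N : ℕ} (a b : ℝ) {x : Fin N → ℝ} (hx : ∀ i, 0 ≤ x i) :
    0 ≤ coulombDensity N a b x :=
  mul_nonneg (Finset.prod_nonneg fun _ _ => Finset.prod_nonneg fun _ _ => abs_nonneg _)
    (Finset.prod_nonneg fun i _ => mul_nonneg (Real.rpow_nonneg (hx i) _) (Real.exp_pos _).le)

lemma continuous_coulombDensity (N : ℕ) {a : ℝ} (ha : 0 ≤ a) (b : ℝ) :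
    Continuous (coulombDensity N a b) := by
  unfold coulombDensity
  have h : ∀ i, Continuous fun x : Fin N → ℝ => x i ^ a := fun i =>
    (continuous_apply i).rpow_const fun _ => Or.inr ha
  fun_prop

/-- The interaction factor of the pair `(i,j)`, each particle sharing its weight equally among
the other particles. -/
noncomputable def pairWeight {N : ℕ} (β : ℝ) (x : Fin N → ℝ) (i j : Fin N) : ℝ :=
  if i = j then 1 else |x i - x j| * (x i ^ β * Real.exp (-x i))

lemma coulombDensity_eq_prod_pairWeight {N : ℕ} (β : ℝ) {x : Fin N → ℝ} (hx : ∀ i, 0 ≤ x i) :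
    coulombDensity N (β * (N - 1)) (N - 1) x = ∏ i, ∏ j, pairWeight β x i j := by
  simp only [coulombDensity, pairWeight, ← prod_compl_singleton_eq, Finset.prod_mul_distrib,
    Finset.prod_const, Finset.card_compl, Finset.card_singleton, Fintype.card_fin]
  congr 2 <;> refine Finset.prod_congr rfl fun i _ => ?_
  · rw [← Real.rpow_mul_natCast (hx i), Nat.cast_sub i.pos, Nat.cast_one]
  · rw [← Real.exp_nat_mul, Nat.cast_sub i.pos, Nat.cast_one, mul_neg]

lemma prod_succAbove_mul_sq {N : ℕ} (g : Fin (N + 1) → Fin (N + 1) → ℝ) (hg : ∀ i, g i i = 1) :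
    (∏ k : Fin (N + 1), ∏ i : Fin N, ∏ j : Fin N, g (k.succAbove i) (k.succAbove j)) *
      (∏ i, ∏ j, g i j) ^ 2 = (∏ i, ∏ j, g i j) ^ (N + 1) := by
  have h : ∀ k : Fin (N + 1), (∏ i : Fin N, ∏ j : Fin N, g (k.succAbove i) (k.succAbove j)) *
      ((∏ i, g i k) * ∏ j, g k j) = ∏ i, ∏ j, g i j := by
    intro k
    rw [Fin.prod_univ_succAbove (fun i => ∏ j, g i j) k,
      Fin.prod_univ_succAbove (fun i => g i k) k]
    have h1 : ∀ i : Fin N, ∏ j, g (k.succAbove i) j =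
        g (k.succAbove i) k * ∏ j : Fin N, g (k.succAbove i) (k.succAbove j) :=
      fun i => Fin.prod_univ_succAbove _ k
    simp only [h1, Finset.prod_mul_distrib, hg]
    ring
  have h2 := Finset.prod_congr rfl fun k (_ : k ∈ Finset.univ) => h k
  rw [Finset.prod_mul_distrib, Finset.prod_mul_distrib, Finset.prod_const, Finset.card_univ,
    Fintype.card_fin, Finset.prod_comm (f := fun k i => g i k)] at h2
  rw [← h2]
  ring

lemma pow_le_of_forall_succAbove {N : ℕ} (hN : 1 ≤ N) {β S : ℝ} {x : Fin (N + 1) → ℝ}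
    (hpos : 0 < ∏ i, ∏ j, pairWeight β x i j) (hx : ∀ i, 0 ≤ x i)
    (h : ∀ k : Fin (N + 1), ∏ i, ∏ j, pairWeight β (x ∘ k.succAbove) i j ≤ S) :
    (∏ i, ∏ j, pairWeight β x i j) ^ (N - 1) ≤ S ^ (N + 1) := by
  have h1 := prod_succAbove_mul_sq (pairWeight β x) (fun i => by simp [pairWeight])
  have h2 : (∏ k : Fin (N + 1), ∏ i : Fin N, ∏ j : Fin N,
      pairWeight β x (k.succAbove i) (k.succAbove j)) =
      (∏ i, ∏ j, pairWeight β x i j) ^ (N - 1) := by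
    refine mul_right_cancel₀ (pow_pos hpos 2).ne' (h1.trans ?_)
    rw [← pow_add]
    congr 1
    omega
  rw [← h2]
  have h3 : ∀ (k : Fin (N + 1)) (i j : Fin N), pairWeight β x (k.succAbove i) (k.succAbove j) =
      pairWeight β (x ∘ k.succAbove) i j := by
    intro k i j
    simp [pairWeight]
  simp only [h3]
  refine (Finset.prod_le_prod (fun k _ => ?_) fun k _ => h k).trans_eq (by simp)
  refine Finset.prod_nonneg fun i _ => Finset.prod_nonneg fun j _ => ?_
  unfold pairWeight
  split_ifs
  · exact zero_le_one
  · exact mul_nonneg (abs_nonneg _) (mul_nonneg (Real.rpow_nonneg (hx _) _) (Real.exp_pos _).le)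

lemma exp_neg_le_prod_abs_sub_div {N i : ℕ} (hi : i < N) :
    Real.exp (-(2 * N)) ≤ ∏ j ∈ Finset.range N, if i = j then 1 else |(i : ℝ) - j| / N := by
  have hN : (0 : ℝ) < N := by exact_mod_cast (by omega : 0 < N)
  have hfac : ∀ r : ℕ, Real.exp (-N) ≤ ∏ j ∈ Finset.range r, ((j + 1 : ℝ) / N) := by
    intro r
    have h1 : ∏ j ∈ Finset.range r, ((j + 1 : ℝ) / N) = (r.factorial : ℝ) / N ^ r := by
      rw [Finset.prod_div_distrib, Finset.prod_const, Finset.card_range,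
        ← Finset.prod_range_add_one_eq_factorial]
      push_cast
      rfl
    rw [h1, Real.exp_neg, ← inv_div]
    exact inv_anti₀ (by positivity) (Real.pow_div_factorial_le_exp _ hN.le r)
  obtain ⟨r, rfl⟩ : ∃ r, N = i + 1 + r := ⟨N - (i + 1), by omega⟩
  rw [Finset.prod_range_add, Finset.prod_range_succ, if_pos rfl, mul_one,
    show -(2 * ((i + 1 + r : ℕ) : ℝ)) = -((i + 1 + r : ℕ) : ℝ) + -((i + 1 + r : ℕ) : ℝ) by ring,
    Real.exp_add]
  refine mul_le_mul ((hfac i).trans_eq ?_) ((hfac r).trans_eq ?_) (Real.exp_pos _).le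
    (Finset.prod_nonneg fun j _ => ?_)
  · rw [← Finset.prod_range_reflect]
    refine Finset.prod_congr rfl fun j hj => ?_
    have hj' := Finset.mem_range.1 hj
    rw [if_neg (by omega)]
    congr 1
    rw [show i - 1 - j = i - (j + 1) by omega, Nat.cast_sub (by omega)]
    have : (j : ℝ) < i := by exact_mod_cast hj'
    rw [abs_of_pos (by linarith)]
    push_cast
    ring
  · refine Finset.prod_congr rfl fun j hj => ?_
    rw [if_neg (by omega)]
    congr 1
    push_cast
    rw [abs_of_neg (by linarith [(Nat.cast_nonneg j : (0 : ℝ) ≤ j)])]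
    ring
  · split_ifs
    · exact zero_le_one
    · positivity

lemma exists_exp_le_prod_pairWeight {c β : ℝ} (hc : 0 < c) (hβ : 0 ≤ β) :
    ∃ K : ℝ, ∀ N : ℕ, ∃ x : Fin N → ℝ, (∀ i, x i ∈ Set.Icc 0 c) ∧
      Real.exp (-(K * N ^ 2)) ≤ ∏ i, ∏ j, pairWeight β x i j := by
  set w : ℝ := c / 2 * ((c / 2) ^ β * Real.exp (-c)) with hw
  have hw0 : 0 < w := by positivity
  refine ⟨2 + |Real.log w|, fun N => ?_⟩
  set x : Fin N → ℝ := fun i => c / 2 + c / 2 * (i / N) with hx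
  have hx1 : ∀ i, x i ∈ Set.Icc (c / 2) c := by
    intro i
    have hN : (0 : ℝ) < N := by exact_mod_cast i.pos
    have h1 : (i : ℝ) / N ≤ 1 := (div_le_one hN).2 (by exact_mod_cast i.isLt.le)
    have h2 : (0 : ℝ) ≤ i / N := by positivity
    constructor <;> simp only [hx] <;> nlinarith
  refine ⟨x, fun i => ⟨by linarith [(hx1 i).1], (hx1 i).2⟩, ?_⟩
  have hwN : Real.exp (-(|Real.log w| * N)) ≤ min 1 w ^ N := by
    have h1 : Real.exp (-|Real.log w|) ≤ min 1 w := by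
      refine le_min (Real.exp_le_one_iff.2 (by simp)) ?_
      calc Real.exp (-|Real.log w|) ≤ Real.exp (Real.log w) :=
            Real.exp_le_exp.2 (neg_abs_le _)
        _ = w := Real.exp_log hw0
    calc Real.exp (-(|Real.log w| * N)) = Real.exp (-|Real.log w|) ^ N := by
          rw [← Real.exp_nat_mul]
          ring_nf
      _ ≤ _ := pow_le_pow_left₀ (Real.exp_pos _).le h1 N
  have hrow : ∀ i : Fin N, Real.exp (-((2 + |Real.log w|) * N)) ≤ ∏ j, pairWeight β x i j := by
    intro i
    have hN : (0 : ℝ) < N := by exact_mod_cast i.pos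
    have h1 := exp_neg_le_prod_abs_sub_div i.isLt
    rw [← Fin.prod_univ_eq_prod_range
      (fun j : ℕ => if (i : ℕ) = j then (1 : ℝ) else |(i : ℝ) - j| / N) N] at h1
    calc Real.exp (-((2 + |Real.log w|) * N)) =
          Real.exp (-(|Real.log w| * N)) * Real.exp (-(2 * N)) := by
          rw [← Real.exp_add]
          ring_nf
      _ ≤ min 1 w ^ N *
          ∏ j : Fin N, if (i : ℕ) = j then (1 : ℝ) else |(i : ℝ) - (j : ℕ)| / N :=
          mul_le_mul hwN h1 (Real.exp_pos _).le (by positivity)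
      _ = ∏ j : Fin N, min 1 w * if (i : ℕ) = j then (1 : ℝ) else |(i : ℝ) - (j : ℕ)| / N := by
          rw [Finset.prod_mul_distrib]
          simp
      _ ≤ _ := by
          refine Finset.prod_le_prod (fun j _ => ?_) fun j _ => ?_
          · split_ifs <;> positivity
          · unfold pairWeight
            by_cases hij : i = j
            · simp [hij]
            · have hij' : (i : ℕ) ≠ j := fun h => hij (Fin.ext h)
              rw [if_neg hij, if_neg hij']
              have h2 : |x i - x j| = c / 2 * (|(i : ℝ) - (j : ℕ)| / N) := by
                have : x i - x j = c / 2 * (((i : ℝ) - (j : ℕ)) / N) := by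
                  simp only [hx]
                  ring
                rw [this, abs_mul, abs_of_pos (half_pos hc), abs_div, abs_of_pos hN]
              have h3 : (c / 2) ^ β * Real.exp (-c) ≤ x i ^ β * Real.exp (-x i) :=
                mul_le_mul (Real.rpow_le_rpow (by positivity) (hx1 i).1 hβ)
                  (Real.exp_le_exp.2 (by linarith [(hx1 i).2])) (Real.exp_pos _).le
                  (Real.rpow_nonneg (by linarith [(hx1 i).1]) _)
              rw [h2]
              calc min 1 w * (|(i : ℝ) - (j : ℕ)| / N) ≤ w * (|(i : ℝ) - (j : ℕ)| / N) := by
                    gcongr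
                    exact min_le_right _ _
                _ = c / 2 * (|(i : ℝ) - (j : ℕ)| / N) * ((c / 2) ^ β * Real.exp (-c)) := by
                    rw [hw]
                    ring
                _ ≤ _ := by gcongr
  calc Real.exp (-((2 + |Real.log w|) * N ^ 2)) =
        ∏ _i : Fin N, Real.exp (-((2 + |Real.log w|) * N)) := by
        rw [Finset.prod_const, Finset.card_univ, Fintype.card_fin, ← Real.exp_nat_mul]
        ring_nf
    _ ≤ _ := Finset.prod_le_prod (fun _ _ => (Real.exp_pos _).le) fun i _ => hrow i

lemma exists_tendsto_max_coulombDensity {c β : ℝ} (hc : 0 < c) (hβ : 0 ≤ β) :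
    ∃ (S : ℕ → ℝ) (L : ℝ), (∀ N, 0 < S N) ∧
      (∀ N (x : Fin N → ℝ), (∀ i, x i ∈ Set.Icc 0 c) →
        coulombDensity N (β * (N - 1)) (N - 1) x ≤ S N) ∧
      (∀ N, ∃ x : Fin N → ℝ, (∀ i, x i ∈ Set.Icc 0 c) ∧ Monotone x ∧
        coulombDensity N (β * (N - 1)) (N - 1) x = S N) ∧
      Tendsto (fun N : ℕ => Real.log (S N) / (N : ℝ) ^ 2) atTop (nhds L) := by
  have hmax : ∀ N : ℕ, ∃ x : Fin N → ℝ, (∀ i, x i ∈ Set.Icc 0 c) ∧ ∀ y : Fin N → ℝ,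
      (∀ i, y i ∈ Set.Icc 0 c) → coulombDensity N (β * (N - 1)) (N - 1) y ≤
        coulombDensity N (β * (N - 1)) (N - 1) x := by
    intro N
    rcases Nat.eq_zero_or_pos N with rfl | hN
    · exact ⟨fun _ => 0, fun i => i.elim0, fun y _ => by simp [coulombDensity]⟩
    · have hN' : (1 : ℝ) ≤ N := by exact_mod_cast hN
      have hcomp : IsCompact (Set.pi Set.univ fun _ : Fin N => Set.Icc 0 c) :=
        isCompact_univ_pi fun _ => isCompact_Icc
      obtain ⟨x, hx, hxmax⟩ := hcomp.exists_isMaxOn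
        ⟨fun _ => 0, fun i _ => ⟨le_rfl, hc.le⟩⟩
        (continuous_coulombDensity N (mul_nonneg hβ (sub_nonneg.2 hN')) (N - 1)).continuousOn
      exact ⟨x, fun i => hx i trivial, fun y hy => hxmax fun i _ => hy i⟩
  choose x hx hxmax using hmax
  set S : ℕ → ℝ := fun N => coulombDensity N (β * (N - 1)) (N - 1) (x N) with hS
  obtain ⟨K, hK⟩ := exists_exp_le_prod_pairWeight hc hβ
  have hlow : ∀ N : ℕ, Real.exp (-(K * N ^ 2)) ≤ S N := by
    intro N
    obtain ⟨y, hy, h⟩ := hK N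
    refine h.trans ?_
    rw [← coulombDensity_eq_prod_pairWeight β fun i => (hy i).1]
    exact hxmax N y hy
  have hpos : ∀ N, 0 < S N := fun N => (Real.exp_pos _).trans_le (hlow N)
  have hrec : ∀ N : ℕ, 1 ≤ N → S (N + 1) ^ (N - 1) ≤ S N ^ (N + 1) := by
    intro N hN
    have h0 := hpos (N + 1)
    simp only [hS] at h0 ⊢
    rw [coulombDensity_eq_prod_pairWeight β fun i => (hx (N + 1) i).1] at h0 ⊢
    refine pow_le_of_forall_succAbove hN h0 (fun i => (hx _ i).1) fun k => ?_
    rw [← coulombDensity_eq_prod_pairWeight (x := x (N + 1) ∘ k.succAbove) β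
      fun i => (hx (N + 1) _).1]
    exact hxmax N _ fun i => hx _ _
  set s : ℕ → ℝ := fun n => Real.log (S (n + 2)) / ((n + 2) * (n + 1)) with hs
  have hanti : Antitone s := by
    refine antitone_nat_of_succ_le fun n => ?_
    have h1 := Real.log_le_log (pow_pos (hpos _) _) (hrec (n + 2) (by omega))
    rw [Real.log_pow, Real.log_pow] at h1
    simp only [hs]
    rw [div_le_div_iff₀ (by positivity) (by positivity)]
    have e : n + 2 - 1 = n + 1 := rfl
    rw [e] at h1
    push_cast at h1 ⊢
    have h2 := mul_le_mul_of_nonneg_left h1 (by positivity : (0 : ℝ) ≤ n + 2)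
    rw [show n + 1 + 2 = n + 2 + 1 from rfl]
    nlinarith [h2]
  have hbdd : BddBelow (Set.range s) := by
    refine ⟨-(2 * |K|), ?_⟩
    rintro _ ⟨n, rfl⟩
    simp only [hs]
    rw [le_div_iff₀ (by positivity)]
    have h1 := (Real.le_log_iff_exp_le (hpos (n + 2))).2 (hlow (n + 2))
    refine le_trans ?_ h1
    push_cast
    have h2 : K * (n + 2) ^ 2 ≤ |K| * (n + 2 : ℝ) ^ 2 := by
      gcongr
      exact le_abs_self K
    have h3 : |K| * (n + 2 : ℝ) ^ 2 ≤ |K| * (2 * ((n + 2) * (n + 1))) := by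
      gcongr
      nlinarith [(Nat.cast_nonneg n : (0 : ℝ) ≤ n)]
    linarith
  have hlim := tendsto_atTop_ciInf hanti hbdd
  refine ⟨S, ⨅ n, s n, hpos, hxmax, fun N => ?_, ?_⟩
  · exact ⟨x N ∘ Tuple.sort (x N), fun i => hx N _, Tuple.monotone_sort _,
      coulombDensity_comp_perm _ _ _ _⟩
  · rw [← tendsto_add_atTop_iff_nat 2]
    have h1 : Tendsto (fun n : ℕ => (n + 1 : ℝ) / (n + 2)) atTop (nhds 1) := by
      have := (tendsto_natCast_div_add_atTop (1 : ℝ)).comp (tendsto_add_atTop_nat 1)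
      refine this.congr fun n => ?_
      simp only [Function.comp_apply]
      push_cast
      ring_nf
    have h2 := hlim.mul h1
    rw [mul_one] at h2
    refine h2.congr fun n => ?_
    simp only [hs]
    push_cast
    have : (n + 1 : ℝ) ≠ 0 := by positivity
    field_simp

end CoulombMaximum

section CoulombLimit

lemma le_one_sub_inv_mul_exp {N : ℕ} (hN : 2 ≤ N) {y : ℝ} (hy : 0 ≤ y) :
    y ≤ Real.exp (2 / N) * ((1 - 1 / N) * y) := by
  have hN' : (2 : ℝ) ≤ N := by exact_mod_cast hN
  have h0 : (0 : ℝ) < N := by linarith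
  have h1 := Real.add_one_le_exp (2 / (N : ℝ))
  have h2 : (1 : ℝ) / N ≤ 1 / 2 := one_div_le_one_div_of_le two_pos hN'
  have h3 : (2 : ℝ) / N = 2 * (1 / N) := by ring
  have h4 : (0 : ℝ) < 1 / N := by positivity
  have h5 : (1 : ℝ) ≤ Real.exp (2 / N) * (1 - 1 / N) := by
    have : (2 / (N : ℝ) + 1) * (1 - 1 / N) ≤ Real.exp (2 / N) * (1 - 1 / N) :=
      mul_le_mul_of_nonneg_right h1 (by linarith)
    rw [h3] at this ⊢
    nlinarith
  nlinarith

/-- The logarithmic cost per particle of changing exponents and rescaling by `1 - 1/N`. -/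
noncomputable def comparisonCost (γ c : ℝ) (N : ℕ) : ℝ :=
  c + 2 * γ + γ * (|Real.log c| + Real.log (2 * N ^ 2)) + 2

lemma rpow_mul_exp_le_comparison {N : ℕ} (hN : 2 ≤ N) {γ c y z p q b b' : ℝ} (hc : 0 < c)
    (hγ : 0 ≤ γ) (hy : 0 ≤ y) (hp : 0 ≤ p) (hpN : p ≤ γ * N) (hpq : |p - q| ≤ γ)
    (hyz : (1 - 1 / N) * y ≤ z) (hz : c / (2 * N ^ 2) ≤ z) (hzc : z ≤ c)
    (hb : b' * z ≤ b * y + c) :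
    y ^ p * Real.exp (-(b * y)) ≤
      Real.exp (comparisonCost γ c N - 2) * (z ^ q * Real.exp (-(b' * z))) := by
  have hN' : (2 : ℝ) ≤ N := by exact_mod_cast hN
  have h0 : (0 : ℝ) < N := by linarith
  have hz0 : 0 < z := lt_of_lt_of_le (by positivity) hz
  have h1 : y ≤ Real.exp (2 / N) * z :=
    (le_one_sub_inv_mul_exp hN hy).trans (mul_le_mul_of_nonneg_left hyz (Real.exp_pos _).le)
  have h2 : y ^ p ≤ Real.exp (2 * γ) * z ^ p := by
    calc y ^ p ≤ (Real.exp (2 / N) * z) ^ p := Real.rpow_le_rpow hy h1 hp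
      _ = Real.exp (2 / N * p) * z ^ p := by
          rw [Real.mul_rpow (Real.exp_pos _).le hz0.le, ← Real.exp_mul]
      _ ≤ Real.exp (2 * γ) * z ^ p := by
          refine mul_le_mul_of_nonneg_right (Real.exp_le_exp.2 ?_) (Real.rpow_nonneg hz0.le _)
          rw [div_mul_eq_mul_div, div_le_iff₀ h0]
          linarith
  have hlog : |Real.log z| ≤ |Real.log c| + Real.log (2 * N ^ 2) := by
    have h3 : 0 ≤ Real.log (2 * (N : ℝ) ^ 2) := Real.log_nonneg (by nlinarith)
    have h4 := Real.log_le_log hz0 hzc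
    have h5 := Real.log_le_log (by positivity) hz
    rw [Real.log_div hc.ne' (by positivity)] at h5
    rw [abs_le]
    constructor <;> linarith [neg_abs_le (Real.log c), le_abs_self (Real.log c)]
  have h6 : z ^ p ≤ Real.exp (γ * (|Real.log c| + Real.log (2 * N ^ 2))) * z ^ q := by
    have : z ^ p = z ^ (p - q) * z ^ q := by rw [← Real.rpow_add hz0, sub_add_cancel]
    rw [this]
    gcongr
    rw [Real.rpow_def_of_pos hz0]
    refine Real.exp_le_exp.2 ((le_abs_self _).trans ?_)
    rw [abs_mul, mul_comm]
    exact mul_le_mul hpq hlog (abs_nonneg _) hγ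
  have h7 : Real.exp (-(b * y)) ≤ Real.exp c * Real.exp (-(b' * z)) := by
    rw [← Real.exp_add]
    exact Real.exp_le_exp.2 (by linarith)
  calc y ^ p * Real.exp (-(b * y)) ≤
      (Real.exp (2 * γ) * (Real.exp (γ * (|Real.log c| + Real.log (2 * N ^ 2))) * z ^ q)) *
        (Real.exp c * Real.exp (-(b' * z))) := by
        refine mul_le_mul (h2.trans ?_) h7 (Real.exp_pos _).le (by positivity)
        gcongr
    _ = _ := by
        rw [comparisonCost, add_sub_cancel_right, Real.exp_add, Real.exp_add]
        ring

lemma coulombDensity_le_comparison {N : ℕ} (hN : 2 ≤ N) {γ c p q b b' : ℝ} {x z : Fin N → ℝ}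
    (hc : 0 < c) (hγ : 0 ≤ γ) (hp : 0 ≤ p) (hpN : p ≤ γ * N) (hpq : |p - q| ≤ γ)
    (hx : ∀ i, 0 ≤ x i) (hxz : ∀ i, (1 - 1 / N) * x i ≤ z i)
    (hdiff : ∀ i j, (1 - 1 / N) * |x i - x j| ≤ |z i - z j|)
    (hz : ∀ i, c / (2 * N ^ 2) ≤ z i) (hzc : ∀ i, z i ≤ c)
    (hb : ∀ i, b' * z i ≤ b * x i + c) :
    coulombDensity N p b x ≤
      Real.exp (N * comparisonCost γ c N) * coulombDensity N q b' z := by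
  have hN' : (2 : ℝ) ≤ N := by exact_mod_cast hN
  have h0 : (0 : ℝ) < N := by linarith
  have hz0 : ∀ i, 0 ≤ z i := fun i => le_trans (by positivity) (hz i)
  have h1 : (∏ i : Fin N, ∏ j ∈ {i}ᶜ, |x i - x j|) ≤
      Real.exp (N * 2) * ∏ i : Fin N, ∏ j ∈ {i}ᶜ, |z i - z j| := by
    have hrow : ∀ i : Fin N, (∏ j ∈ {i}ᶜ, |x i - x j|) ≤
        Real.exp 2 * ∏ j ∈ {i}ᶜ, |z i - z j| := by
      intro i
      calc (∏ j ∈ {i}ᶜ, |x i - x j|) ≤ ∏ j ∈ {i}ᶜ, (Real.exp (2 / N) * |z i - z j|) := by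
            refine Finset.prod_le_prod (fun _ _ => abs_nonneg _) fun j _ => ?_
            exact (le_one_sub_inv_mul_exp hN (abs_nonneg _)).trans
              (mul_le_mul_of_nonneg_left (hdiff i j) (Real.exp_pos _).le)
        _ = Real.exp ((N - 1 : ℕ) * (2 / N)) * ∏ j ∈ {i}ᶜ, |z i - z j| := by
            rw [Finset.prod_mul_distrib, Finset.prod_const, Finset.card_compl,
              Finset.card_singleton, Fintype.card_fin, ← Real.exp_nat_mul]
        _ ≤ _ := by
            refine mul_le_mul_of_nonneg_right (Real.exp_le_exp.2 ?_)
              (Finset.prod_nonneg fun _ _ => abs_nonneg _)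
            have : ((N - 1 : ℕ) : ℝ) ≤ N := by exact_mod_cast Nat.sub_le N 1
            calc ((N - 1 : ℕ) : ℝ) * (2 / N) ≤ N * (2 / N) := by gcongr
              _ = 2 := by field_simp
    refine (Finset.prod_le_prod (fun i _ => Finset.prod_nonneg fun _ _ => abs_nonneg _)
      fun i _ => hrow i).trans_eq ?_
    rw [Finset.prod_mul_distrib, Finset.prod_const, Finset.card_univ, Fintype.card_fin,
      ← Real.exp_nat_mul]
  have h2 : (∏ i, (x i ^ p * Real.exp (-(b * x i)))) ≤
      Real.exp (N * (comparisonCost γ c N - 2)) * ∏ i, (z i ^ q * Real.exp (-(b' * z i))) := by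
    refine (Finset.prod_le_prod
      (fun i _ => mul_nonneg (Real.rpow_nonneg (hx i) _) (Real.exp_pos _).le) fun i _ =>
      rpow_mul_exp_le_comparison hN hc hγ (hx i) hp hpN hpq (hxz i) (hz i) (hzc i)
        (hb i)).trans_eq ?_
    rw [Finset.prod_mul_distrib, Finset.prod_const, Finset.card_univ, Fintype.card_fin,
      ← Real.exp_nat_mul]
  calc coulombDensity N p b x ≤
      (Real.exp (N * 2) * ∏ i : Fin N, ∏ j ∈ {i}ᶜ, |z i - z j|) *
        (Real.exp (N * (comparisonCost γ c N - 2)) *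
          ∏ i, (z i ^ q * Real.exp (-(b' * z i)))) := by
        refine mul_le_mul h1 h2 (Finset.prod_nonneg fun i _ =>
          mul_nonneg (Real.rpow_nonneg (hx i) _) (Real.exp_pos _).le) ?_
        exact mul_nonneg (Real.exp_pos _).le
          (Finset.prod_nonneg fun _ _ => Finset.prod_nonneg fun _ _ => abs_nonneg _)
    _ = _ := by
        rw [coulombDensity, mul_mul_mul_comm, ← Real.exp_add]
        ring_nf

lemma floor_mul_sub_bounds {γ : ℝ} (hγ : 1 ≤ γ) {N : ℕ} (hN : 1 ≤ N) :
    N ≤ ⌊γ * N⌋₊ ∧ ((⌊γ * N⌋₊ - N : ℕ) : ℝ) ≤ γ * N ∧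
      |((⌊γ * N⌋₊ - N : ℕ) : ℝ) - (γ - 1) * (N - 1)| ≤ γ := by
  have hN' : (1 : ℝ) ≤ N := by exact_mod_cast hN
  have h0 : 0 ≤ γ * N := by positivity
  have h1 : N ≤ ⌊γ * N⌋₊ := Nat.le_floor (by nlinarith)
  have h2 := Nat.floor_le h0
  have h3 := Nat.lt_floor_add_one (γ * N)
  rw [Nat.cast_sub h1]
  refine ⟨h1, by linarith, ?_⟩
  rw [abs_le]
  constructor <;> nlinarith

lemma coulombDensity_le_of_max {γ c S : ℝ} (hγ : 1 ≤ γ) (hc : 0 < c) {N : ℕ} (hN : 2 ≤ N)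
    (hS : ∀ x : Fin N → ℝ, (∀ i, x i ∈ Set.Icc 0 c) →
      coulombDensity N ((γ - 1) * (N - 1)) (N - 1) x ≤ S)
    {x : Fin N → ℝ} (hx : ∀ i, x i ∈ Set.Icc 0 c) :
    coulombDensity N (⌊γ * N⌋₊ - N : ℕ) N x ≤ Real.exp (N * comparisonCost γ c N) * S := by
  have hN' : (2 : ℝ) ≤ N := by exact_mod_cast hN
  have h0 : (0 : ℝ) < N := by linarith
  obtain ⟨-, h2, h3⟩ := floor_mul_sub_bounds hγ (by omega : 1 ≤ N)
  have hcN : 0 < c / N := by positivity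
  have hN1 : (0 : ℝ) ≤ 1 - 1 / N := by
    rw [sub_nonneg, div_le_one h0]
    linarith
  set z : Fin N → ℝ := fun i => (1 - 1 / N) * x i + c / N with hz
  have hzc : ∀ i, z i ≤ c := by
    intro i
    have h4 := mul_le_mul_of_nonneg_left (hx i).2 hN1
    have h5 : (1 - 1 / (N : ℝ)) * c + c / N = c := by ring
    simp only [hz]
    linarith
  have hz0 : ∀ i, c / N ≤ z i := fun i => by
    have := mul_nonneg hN1 (hx i).1
    simp only [hz]
    linarith
  refine (coulombDensity_le_comparison (z := z) (q := (γ - 1) * (N - 1)) (b' := N - 1) hN hc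
    (by linarith) (Nat.cast_nonneg _) h2 h3
    (fun i => (hx i).1) (fun i => ?_) (fun i j => ?_) (fun i => ?_) hzc fun i => ?_).trans ?_
  · simp only [hz]
    linarith
  · simp only [hz, add_sub_add_right_eq_sub, ← mul_sub]
    rw [abs_mul, abs_of_nonneg hN1]
  · refine le_trans ?_ (hz0 i)
    gcongr
    nlinarith
  · have h4 : ((N : ℝ) - 1) * z i =
        N * x i + c - ((2 - 1 / N) * x i + c / N) := by
      simp only [hz]
      field_simp
      ring
    have h5 : (0 : ℝ) ≤ (2 - 1 / N) * x i := mul_nonneg (by linarith) (hx i).1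
    linarith
  · gcongr
    exact hS z fun i => ⟨hcN.le.trans (hz0 i), hzc i⟩

lemma max_le_coulombDensity {γ c : ℝ} (hγ : 1 ≤ γ) (hc : 0 < c) {N : ℕ} (hN : 2 ≤ N)
    {x z : Fin N → ℝ} (hx : ∀ i, x i ∈ Set.Icc 0 c) (hmono : Monotone x)
    (hz : ∀ i : Fin N, z i ∈ Set.Icc ((1 - 1 / N) * x i + c / (2 * N ^ 2) * (2 * i + 1))
      ((1 - 1 / N) * x i + c / (2 * N ^ 2) * (2 * i + 1) + c / (2 * N ^ 2))) :
    (∀ i, z i ∈ Set.Icc 0 c) ∧ coulombDensity N ((γ - 1) * (N - 1)) (N - 1) x ≤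
      Real.exp (N * comparisonCost γ c N) * coulombDensity N (⌊γ * N⌋₊ - N : ℕ) N z := by
  have hN' : (2 : ℝ) ≤ N := by exact_mod_cast hN
  have h0 : (0 : ℝ) < N := by linarith
  obtain ⟨-, h2, h3⟩ := floor_mul_sub_bounds hγ (by omega : 1 ≤ N)
  set η : ℝ := c / (2 * N ^ 2) with hη
  have hη0 : 0 < η := by positivity
  have hηN : η * (2 * N) = c / N := by
    rw [hη]
    field_simp
  have hN1 : (0 : ℝ) ≤ 1 - 1 / N := by
    rw [sub_nonneg, div_le_one h0]
    linarith
  have hup : ∀ i, z i ≤ (1 - 1 / N) * x i + c / N := by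
    intro i
    have hi : ((i : ℕ) : ℝ) + 1 ≤ N := by exact_mod_cast i.isLt
    have h4 := (hz i).2
    have h5 := mul_le_mul_of_nonneg_left hi hη0.le
    linarith
  have hzc : ∀ i, z i ≤ c := by
    intro i
    have h4 := mul_le_mul_of_nonneg_left (hx i).2 hN1
    have h5 : (1 - 1 / (N : ℝ)) * c + c / N = c := by ring
    linarith [hup i]
  have hlow : ∀ i, (1 - 1 / N) * x i + η ≤ z i := by
    intro i
    have h4 := (hz i).1
    have h5 : 0 ≤ η * ((i : ℕ) : ℝ) := by positivity
    linarith
  have hηz : ∀ i, η ≤ z i := fun i => by linarith [hlow i, mul_nonneg hN1 (hx i).1]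
  have hlt : ∀ i j : Fin N, i < j → (1 - 1 / N) * |x j - x i| ≤ |z j - z i| := by
    intro i j hij
    have h4 : ((i : ℕ) : ℝ) + 1 ≤ (j : ℕ) := by exact_mod_cast hij
    have h5 := mul_le_mul_of_nonneg_left h4 hη0.le
    rw [abs_of_nonneg (sub_nonneg.2 (hmono hij.le))]
    refine le_trans ?_ (le_abs_self _)
    linarith [(hz i).2, (hz j).1]
  refine ⟨fun i => ⟨hη0.le.trans (hηz i), hzc i⟩, ?_⟩
  refine coulombDensity_le_comparison hN hc (by linarith)
    (mul_nonneg (by linarith) (by linarith)) (by nlinarith) (by rwa [abs_sub_comm])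
    (fun i => (hx i).1) (fun i => by linarith [hlow i]) (fun i j => ?_) hηz hzc fun i => ?_
  · rcases lt_trichotomy i j with h | h | h
    · rw [abs_sub_comm (x i), abs_sub_comm (z i)]
      exact hlt i j h
    · simp [h]
    · exact hlt j i h
  · have h4 := mul_le_mul_of_nonneg_left (hup i) h0.le
    have h5 : (N : ℝ) * ((1 - 1 / N) * x i + c / N) = (N - 1) * x i + c := by
      field_simp
    linarith

lemma tendsto_log_coulombIntegral {γ c : ℝ} (hγ : 1 ≤ γ) (hc : 0 < c) :
    (∀ N : ℕ, 2 ≤ N → 0 < coulombIntegral N (⌊γ * N⌋₊ - N : ℕ) N c) ∧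
    ∃ L : ℝ, Tendsto (fun N : ℕ =>
      Real.log (coulombIntegral N (⌊γ * N⌋₊ - N : ℕ) N c) / (N : ℝ) ^ 2) atTop (nhds L) := by
  obtain ⟨S, L, hpos, hmax, hatt, hlim⟩ :=
    exists_tendsto_max_coulombDensity hc (sub_nonneg.2 hγ)
  have hbound : ∀ N : ℕ, 2 ≤ N →
      (c / (2 * N ^ 2)) ^ N * (Real.exp (-(N * comparisonCost γ c N)) * S N) ≤
        coulombIntegral N (⌊γ * N⌋₊ - N : ℕ) N c ∧
      coulombIntegral N (⌊γ * N⌋₊ - N : ℕ) N c ≤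
        c ^ N * (Real.exp (N * comparisonCost γ c N) * S N) := by
    intro N hN
    have hN' : (2 : ℝ) ≤ N := by exact_mod_cast hN
    have h0 : (0 : ℝ) < N := by linarith
    set a : ℝ := ((⌊γ * N⌋₊ - N : ℕ) : ℝ) with ha
    have hcont : Continuous (coulombDensity N a N) :=
      continuous_coulombDensity N (Nat.cast_nonneg _) _
    set B : Set (Fin N → ℝ) := Set.pi Set.univ fun _ => Set.Icc 0 c with hB
    have hBcomp : IsCompact B := isCompact_univ_pi fun _ => isCompact_Icc
    have hBvol : volume.real B = c ^ N := by
      rw [Measure.real, hB, volume_pi_pi]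
      simp [hc.le]
    have hint : IntegrableOn (coulombDensity N a N) B :=
      hcont.continuousOn.integrableOn_compact hBcomp
    have hnn : ∀ x ∈ B, 0 ≤ coulombDensity N a N x := fun x hx =>
      coulombDensity_nonneg _ _ fun i => (hx i trivial).1
    constructor
    · obtain ⟨x, hx, hmono, hxS⟩ := hatt N
      set η : ℝ := c / (2 * N ^ 2) with hη
      have hη0 : 0 < η := by positivity
      set A : Set (Fin N → ℝ) := Set.pi Set.univ fun i => Set.Icc
        ((1 - 1 / N) * x i + η * (2 * i + 1)) ((1 - 1 / N) * x i + η * (2 * i + 1) + η) with hA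
      have hAvol : volume.real A = η ^ N := by
        rw [Measure.real, hA, volume_pi_pi]
        simp [hη0.le]
      have hAmeas : MeasurableSet A := MeasurableSet.univ_pi fun _ => measurableSet_Icc
      have hAB : ∀ z ∈ A, z ∈ B ∧ Real.exp (-(N * comparisonCost γ c N)) * S N ≤
          coulombDensity N a N z := by
        intro z hz
        obtain ⟨h1, h2⟩ := max_le_coulombDensity hγ hc hN hx hmono fun i => hz i trivial
        refine ⟨fun i _ => h1 i, ?_⟩
        rw [Real.exp_neg, inv_mul_le_iff₀ (Real.exp_pos _), ← hxS]
        exact h2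
      have hAfin : volume A ≠ ⊤ :=
        (isCompact_univ_pi fun _ => isCompact_Icc).measure_lt_top.ne
      calc η ^ N * (Real.exp (-(N * comparisonCost γ c N)) * S N)
          = ∫ _ in A, Real.exp (-(N * comparisonCost γ c N)) * S N := by
            rw [setIntegral_const, hAvol, smul_eq_mul]
        _ ≤ ∫ z in A, coulombDensity N a N z :=
            setIntegral_mono_on (integrableOn_const hAfin)
              (hint.mono_set fun z hz => (hAB z hz).1) hAmeas fun z hz => (hAB z hz).2
        _ ≤ ∫ z in B, coulombDensity N a N z :=
            setIntegral_mono_set hint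
              ((ae_restrict_iff' hBcomp.measurableSet).2 (Eventually.of_forall hnn))
              (Eventually.of_forall fun z hz => (hAB z hz).1)
    · calc coulombIntegral N a N c
          ≤ ∫ _ in B, Real.exp (N * comparisonCost γ c N) * S N :=
            setIntegral_mono_on hint (integrableOn_const hBcomp.measure_lt_top.ne)
              hBcomp.measurableSet fun x hx =>
                coulombDensity_le_of_max hγ hc hN (hmax N) fun i => hx i trivial
        _ = _ := by rw [setIntegral_const, hBvol, smul_eq_mul]
  have hJpos : ∀ N : ℕ, 2 ≤ N → 0 < coulombIntegral N (⌊γ * N⌋₊ - N : ℕ) N c := by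
    intro N hN
    have h0 : (0 : ℝ) < N := by exact_mod_cast (by omega : 0 < N)
    have := hpos N
    exact lt_of_lt_of_le (by positivity) (hbound N hN).1
  refine ⟨hJpos, L, ?_⟩
  have hlog : Tendsto (fun N : ℕ => Real.log (2 * (N : ℝ) ^ 2) / N) atTop (nhds 0) := by
    have h1 : Tendsto (fun N : ℕ => Real.log 2 / (N : ℝ)) atTop (nhds 0) :=
      tendsto_const_div_atTop_nhds_zero_nat _
    have h2 : Tendsto (fun N : ℕ => Real.log N / (N : ℝ)) atTop (nhds 0) :=
      (Real.isLittleO_log_id_atTop.tendsto_div_nhds_zero).comp tendsto_natCast_atTop_atTop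
    have h3 := h1.add (h2.const_mul 2)
    rw [mul_zero, add_zero] at h3
    refine h3.congr' ?_
    filter_upwards [eventually_ge_atTop 1] with N hN
    have h0 : (N : ℝ) ≠ 0 := by exact_mod_cast (by omega : N ≠ 0)
    rw [Real.log_mul two_ne_zero (pow_ne_zero 2 h0), Real.log_pow]
    push_cast
    ring
  have hcost : Tendsto (fun N : ℕ => comparisonCost γ c N / N) atTop (nhds 0) := by
    have h1 := (tendsto_const_div_atTop_nhds_zero_nat
      (c + 2 * γ + γ * |Real.log c| + 2)).add (hlog.const_mul γ)
    rw [mul_zero, add_zero] at h1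
    refine h1.congr fun N => ?_
    rw [comparisonCost]
    ring
  have hlow := ((tendsto_const_div_atTop_nhds_zero_nat (Real.log c)).sub hlog).sub hcost
  have hup := (tendsto_const_div_atTop_nhds_zero_nat (Real.log c)).add hcost
  rw [sub_zero, sub_zero] at hlow
  rw [add_zero] at hup
  have hlow' := hlow.add hlim
  have hup' := hup.add hlim
  rw [zero_add] at hlow' hup'
  refine tendsto_of_tendsto_of_tendsto_of_le_of_le' hlow' hup' ?_ ?_
  all_goals
    filter_upwards [eventually_ge_atTop 2] with N hN
    have h0 : (0 : ℝ) < N := by exact_mod_cast (by omega : 0 < N)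
    have hSN := hpos N
  · have h1 := Real.log_le_log (by positivity) (hbound N hN).1
    rw [Real.log_mul (by positivity) (by positivity), Real.log_pow,
      Real.log_mul (by positivity) hSN.ne', Real.log_exp,
      Real.log_div hc.ne' (by positivity)] at h1
    rw [le_div_iff₀ (by positivity)]
    refine le_trans (le_of_eq ?_) h1
    field_simp
    ring
  · have h1 := Real.log_le_log (hJpos N hN) (hbound N hN).2
    rw [Real.log_mul (by positivity) (by positivity), Real.log_pow,
      Real.log_mul (by positivity) hSN.ne', Real.log_exp] at h1
    rw [div_le_iff₀ (by positivity)]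
    refine h1.trans (le_of_eq ?_)
    field_simp
    ring

end CoulombLimit

section LowerTail

open ProbabilityTheory

lemma lintegral_exp_half_expMeasure_one :
    ∫⁻ r, ENNReal.ofReal (Real.exp (r / 2)) ∂(expMeasure 1) = 2 := by
  have ha : (-(1 / 2) : ℝ) < 0 := by norm_num
  rw [lintegral_expMeasure_one (by fun_prop), setLIntegral_congr Ioi_ae_eq_Ici.symm]
  have h : ∀ r : ℝ, ENNReal.ofReal (Real.exp (-r)) * ENNReal.ofReal (Real.exp (r / 2)) =
      ENNReal.ofReal (Real.exp (-(1 / 2) * r)) := by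
    intro r
    rw [← ENNReal.ofReal_mul (Real.exp_pos _).le, ← Real.exp_add]
    ring_nf
  simp only [h]
  rw [← ofReal_integral_eq_lintegral_ofReal (integrableOn_exp_mul_Ioi ha 0)
    (Eventually.of_forall fun _ => (Real.exp_pos _).le), integral_exp_mul_Ioi ha]
  norm_num

variable {Ω : Type*} [MeasurableSpace Ω] {μ : Measure Ω} {v : ℕ × ℕ → Ω → ℝ}

lemma IsExpWeights.lintegral_exp_half_lastPassage_le [IsProbabilityMeasure μ]
    (hv : IsExpWeights μ v) (m n : ℕ) :
    ∫⁻ ω, ENNReal.ofReal (Real.exp (lastPassage (fun p => v p ω) m n / 2)) ∂μ ≤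
      4 ^ (m + n) := by
  have hone : ∀ k : ℕ, (1 : ENNReal) ≤ 4 ^ k := fun k => one_le_pow₀ (by norm_num)
  induction m generalizing n with
  | zero => simpa using hone n
  | succ m ihm =>
    induction n with
    | zero => simpa using hone (m + 1)
    | succ n ihn =>
      set E : ℕ → ℕ → Ω → ENNReal := fun a b ω =>
        ENNReal.ofReal (Real.exp (lastPassage (fun p => v p ω) a b / 2)) with hE
      set S : Set (ℕ × ℕ) := {p | p ≠ (m + 1, n + 1)} with hS
      have hEm : ∀ a b, (a ≤ m ∨ b ≤ n) → Measurable[weightSigma v S] (E a b) := by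
        intro a b hab
        have h1 : Measurable[weightSigma v S] fun ω => lastPassage (fun p => v p ω) a b := by
          refine measurable_lastPassage_of_le fun p h1 h2 => measurable_weightSigma v ?_
          rintro rfl
          simp only at h1 h2
          omega
        exact ENNReal.measurable_ofReal.comp
          (Real.measurable_exp.comp (h1.div_const 2))
      have hEm' : ∀ a b, Measurable (E a b) := fun a b =>
        ENNReal.measurable_ofReal.comp
          (Real.measurable_exp.comp ((hv.measurable_lastPassage a b).div_const 2))
      have hg : Measurable fun r : ℝ => ENNReal.ofReal (Real.exp (r / 2)) := by fun_prop
      set Y : Ω → ENNReal := fun ω => ENNReal.ofReal (Real.exp (v (m + 1, n + 1) ω / 2)) with hY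
      have hYm : Measurable[weightSigma v Sᶜ] Y :=
        hg.comp (measurable_weightSigma v (by simp [hS]))
      have hind : IndepFun (fun ω => E m (n + 1) ω + E (m + 1) n ω) Y μ :=
        hv.indepFun disjoint_compl_right
          ((hEm m (n + 1) (Or.inl le_rfl)).add (hEm (m + 1) n (Or.inr le_rfl))) hYm
      have hYint : ∫⁻ ω, Y ω ∂μ = 2 := by
        rw [← lintegral_exp_half_expMeasure_one, ← hv.map_eq (m + 1, n + 1),
          lintegral_map hg (hv.measurable _)]
      calc ∫⁻ ω, E (m + 1) (n + 1) ω ∂μ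
          ≤ ∫⁻ ω, (E m (n + 1) ω + E (m + 1) n ω) * Y ω ∂μ := by
            refine lintegral_mono fun ω => ?_
            simp only [hE, hY, lastPassage_succ]
            rw [add_div, Real.exp_add, ENNReal.ofReal_mul (Real.exp_pos _).le]
            gcongr
            rcases max_cases (lastPassage (fun p => v p ω) m (n + 1))
              (lastPassage (fun p => v p ω) (m + 1) n) with h | h
            · rw [h.1]
              exact le_self_add
            · rw [h.1]
              exact le_add_self
        _ = (∫⁻ ω, E m (n + 1) ω ∂μ + ∫⁻ ω, E (m + 1) n ω ∂μ) * 2 := by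
            have hmul := lintegral_mul_eq_lintegral_mul_lintegral_of_indepFun'' (μ := μ)
              (f := fun ω => E m (n + 1) ω + E (m + 1) n ω) (g := Y)
              ((hEm' _ _).add (hEm' _ _)).aemeasurable
              (hg.comp (hv.measurable _)).aemeasurable hind
            rw [hmul, hYint, lintegral_add_left (hEm' _ _)]
        _ ≤ (4 ^ (m + (n + 1)) + 4 ^ (m + 1 + n)) * 2 := by
            gcongr
            · exact ihm (n + 1)
        _ = 4 ^ (m + 1 + (n + 1)) := by
            rw [show m + 1 + n = m + (n + 1) by omega,
              show m + 1 + (n + 1) = m + (n + 1) + 1 by omega, pow_succ, ← mul_two, mul_assoc]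
            norm_num

lemma IsExpWeights.half_le_measure_lastPassage_le [IsProbabilityMeasure μ]
    (hv : IsExpWeights μ v) {γ : ℝ} (hγ : 0 ≤ γ) {N : ℕ} (hN : 1 ≤ N) :
    1 / 2 ≤ μ.real {ω | lastPassage (fun p => v p ω) ⌊γ * N⌋₊ N ≤ N * (4 * (γ + 1) + 2)} := by
  set G : Ω → ℝ := fun ω => lastPassage (fun p => v p ω) ⌊γ * N⌋₊ N with hG
  set K : ℝ := 4 * (γ + 1) + 2 with hK
  have hN' : (1 : ℝ) ≤ N := by exact_mod_cast hN
  have hGm : Measurable G := hv.measurable_lastPassage _ _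
  have hset : {ω | G ω ≤ N * K} = {ω | N * K < G ω}ᶜ := by
    ext ω
    simp
  have hmarkov := meas_ge_le_lintegral_div (μ := μ)
    (f := fun ω => ENNReal.ofReal (Real.exp (G ω / 2)))
    (by fun_prop) (ε := ENNReal.ofReal (Real.exp (N * K / 2)))
    (by simp [Real.exp_pos]) ENNReal.ofReal_ne_top
  have hpow : (4 : ENNReal) ^ (⌊γ * N⌋₊ + N) ≤ ENNReal.ofReal (Real.exp (2 * (γ + 1) * N)) := by
    have h4 : (4 : ℝ) ≤ Real.exp 2 := by
      have h1 := Real.add_one_le_exp (1 : ℝ)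
      rw [show (2 : ℝ) = 1 + 1 by norm_num, Real.exp_add]
      nlinarith
    have h5 : (4 : ℝ) ^ (⌊γ * N⌋₊ + N) ≤ Real.exp (2 * (γ + 1) * N) := by
      refine (pow_le_pow_left₀ (by norm_num) h4 _).trans ?_
      rw [← Real.exp_nat_mul]
      refine Real.exp_le_exp.2 ?_
      have := Nat.floor_le (by positivity : 0 ≤ γ * N)
      push_cast
      linarith
    have h6 := ENNReal.ofReal_le_ofReal h5
    rwa [ENNReal.ofReal_pow (by norm_num), show ENNReal.ofReal 4 = 4 by norm_num] at h6
  have htail : μ.real {ω | N * K < G ω} ≤ 1 / 2 := by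
    have h1 : μ {ω | N * K < G ω} ≤ ENNReal.ofReal (1 / 2) := by
      calc μ {ω | N * K < G ω}
          ≤ μ {ω | ENNReal.ofReal (Real.exp (N * K / 2)) ≤
              ENNReal.ofReal (Real.exp (G ω / 2))} := by
            refine measure_mono fun ω hω => ?_
            have hω' : N * K < G ω := hω
            exact ENNReal.ofReal_le_ofReal (Real.exp_le_exp.2 (by linarith))
        _ ≤ _ := hmarkov
        _ ≤ ENNReal.ofReal (Real.exp (2 * (γ + 1) * N)) /
              ENNReal.ofReal (Real.exp (N * K / 2)) := by
            gcongr
            exact (hv.lintegral_exp_half_lastPassage_le _ _).trans hpow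
        _ = ENNReal.ofReal (Real.exp (-N)) := by
            rw [← ENNReal.ofReal_div_of_pos (Real.exp_pos _), ← Real.exp_sub]
            congr 2
            rw [hK]
            ring
        _ ≤ _ := by
            refine ENNReal.ofReal_le_ofReal ?_
            rw [Real.exp_neg, one_div]
            refine inv_anti₀ two_pos ?_
            linarith [Real.add_one_le_exp (N : ℝ)]
    exact ENNReal.toReal_le_of_le_ofReal (by norm_num) h1
  rw [hset, probReal_compl_eq_one_sub (measurableSet_lt measurable_const hGm)]
  linarith

/-- Lower-tail large deviations at speed `N ^ 2`. -/
theorem IsExpWeights.exists_tendsto_lowerTail [IsProbabilityMeasure μ] (hv : IsExpWeights μ v)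
    {γ : ℝ} (hγ : 1 ≤ γ) (a : ℝ) :
    ∃ l : ℝ, Tendsto (fun N : ℕ => (1 / (N : ℝ) ^ 2) *
      Real.log (μ {ω | lastPassage (fun p => v p ω) ⌊γ * N⌋₊ N ≤ N * a}).toReal)
      atTop (nhds (-l)) := by
  rcases le_or_gt a 0 with ha | ha
  · refine ⟨0, ?_⟩
    rw [neg_zero]
    refine tendsto_const_nhds.congr' ?_
    filter_upwards [eventually_ge_atTop 1] with N hN
    have hM : 1 ≤ ⌊γ * N⌋₊ := hN.trans (floor_mul_sub_bounds hγ hN).1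
    have hzero : μ {ω | lastPassage (fun p => v p ω) ⌊γ * N⌋₊ N ≤ N * a} = 0 := by
      have h0 : μ {ω | v (1, 1) ω ≤ 0} = 0 := by
        rw [hv.cdf _ _ le_rfl]
        simp
      refine measure_mono_null (fun ω hω => ?_) h0
      have h1 := lastPassage_mono (fun p => hv.nonneg p ω) hM hN
      have h2 : lastPassage (fun p => v p ω) ⌊γ * N⌋₊ N ≤ N * a := hω
      have h3 : (N : ℝ) * a ≤ 0 := mul_nonpos_of_nonneg_of_nonpos (Nat.cast_nonneg N) ha
      have h4 : lastPassage (fun p => v p ω) 1 1 = v (1, 1) ω := by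
        rw [lastPassage_succ]
        simp
      change v (1, 1) ω ≤ 0
      linarith
    rw [hzero]
    simp
  · set K : ℝ := 4 * (γ + 1) + 2 with hK
    have hK0 : 0 < K := by positivity
    obtain ⟨hpos_a, La, hLa⟩ := tendsto_log_coulombIntegral hγ ha
    obtain ⟨hpos_K, LK, hLK⟩ := tendsto_log_coulombIntegral hγ hK0
    refine ⟨LK - La, ?_⟩
    set P : ℕ → ℝ → ℝ := fun N c =>
      μ.real {ω | lastPassage (fun p => v p ω) ⌊γ * N⌋₊ N ≤ N * c} with hP
    have hprob : Tendsto (fun N : ℕ => Real.log (P N K) / (N : ℝ) ^ 2) atTop (nhds 0) := by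
      have hsq : Tendsto (fun N : ℕ => Real.log (1 / 2) / (N : ℝ) ^ 2) atTop (nhds 0) :=
        tendsto_const_nhds.div_atTop
          ((tendsto_pow_atTop two_ne_zero).comp tendsto_natCast_atTop_atTop)
      refine tendsto_of_tendsto_of_tendsto_of_le_of_le' hsq tendsto_const_nhds ?_ ?_
      all_goals
        filter_upwards [eventually_ge_atTop 1] with N hN
        have h1 := hv.half_le_measure_lastPassage_le (by linarith : 0 ≤ γ) hN
      · gcongr
      · refine div_nonpos_of_nonpos_of_nonneg ?_ (by positivity)
        exact Real.log_nonpos (le_trans (by norm_num) h1) measureReal_le_one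
    have hlim := (hLa.sub hLK).add hprob
    rw [add_zero, ← neg_sub] at hlim
    refine hlim.congr' ?_
    filter_upwards [eventually_ge_atTop 2] with N hN
    have hN1 : 1 ≤ N := by omega
    obtain ⟨C, hC, hCeq⟩ :=
      exists_jointDet_eq_coulombIntegral hN1 (floor_mul_sub_bounds hγ hN1).1
    have hN0 : (0 : ℝ) < N := by exact_mod_cast hN1
    obtain ⟨D, hD, hDeq⟩ : ∃ D : ℝ, 0 < D ∧ ∀ c : ℝ, 0 < c →
        P N c = D * coulombIntegral N (⌊γ * N⌋₊ - N : ℕ) N c := by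
      refine ⟨C * ((N : ℝ) ^ N * ((N : ℝ) ^ (N * (N - 1)) *
        (N : ℝ) ^ ((⌊γ * N⌋₊ - N) * N))), by positivity, fun c hc => ?_⟩
      have ht : 0 ≤ N * c := by positivity
      simp only [hP]
      rw [hv.measure_lastPassage_le _ hN1 ht, hCeq _ ht, coulombIntegral_scale hN1, mul_assoc C]
    have hJa := hpos_a N hN
    have hJK := hpos_K N hN
    change _ = 1 / (N : ℝ) ^ 2 * Real.log (P N a)
    rw [hDeq a ha, hDeq K hK0, Real.log_mul hD.ne' hJa.ne', Real.log_mul hD.ne' hJK.ne']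
    ring

end LowerTail

section PositivePart

open ProbabilityTheory

variable {Ω : Type*} [MeasurableSpace Ω] {μ : Measure Ω} {u : ℕ × ℕ → Ω → ℝ}

lemma isExpWeights_max_zero (hmeas : ∀ p, Measurable (u p)) (hindep : iIndepFun u μ)
    (hexp : ∀ p t, 0 ≤ t → μ {ω | u p ω ≤ t} = ENNReal.ofReal (1 - Real.exp (-t))) :
    IsExpWeights μ fun p ω => max (u p ω) 0 where
  measurable p := (hmeas p).max measurable_const
  nonneg p ω := le_max_right _ _
  indep := hindep.comp (fun _ x => max x 0) fun _ => measurable_id.max measurable_const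
  cdf p t ht := by
    rw [← hexp p t ht]
    congr 1
    ext ω
    simp [ht]

lemma ae_lppSupR_eq_lastPassage
    (hexp : ∀ p t, 0 ≤ t → μ {ω | u p ω ≤ t} = ENNReal.ofReal (1 - Real.exp (-t)))
    {M N : ℕ} (hM : 1 ≤ M) (hN : 1 ≤ N) :
    ∀ᵐ ω ∂μ, lppSupR (fun p => u p ω) M N = lastPassage (fun p => max (u p ω) 0) M N := by
  have h : ∀ᵐ ω ∂μ, ∀ p, 0 ≤ u p ω := by
    refine ae_all_iff.2 fun p => ?_
    have h0 : μ {ω | u p ω ≤ 0} = 0 := by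
      rw [hexp p 0 le_rfl]
      simp
    refine measure_mono_null (fun ω hω => ?_) h0
    exact (le_total 0 (u p ω)).resolve_left hω
  filter_upwards [h] with ω hω
  rw [lppSupR_eq_lastPassage hω hM hN]
  congr 1
  funext p
  exact (max_eq_left (hω p)).symm

end PositivePart

/-- Large deviations for `H(⌊γN⌋,N)`: both the lower-tail `N⁻²`-scale and upper-tail
`N⁻¹`-scale logarithmic limits exist, equal to `−ℓ_*(ε)` and `−i_*(ε)` respectively. -/
theorem stmt7
    {Ω : Type*} [MeasurableSpace Ω] (ℙ : Measure Ω) [IsProbabilityMeasure ℙ]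
    (u : ℕ × ℕ → Ω → ℝ)
    (hmeas : ∀ p, Measurable (u p))
    (hindep : ProbabilityTheory.iIndepFun u ℙ)
    (hexp : ∀ p t, 0 ≤ t → ℙ {ω | u p ω ≤ t} = ENNReal.ofReal (1 - Real.exp (-t)))
    (γ : ℝ) (hγ : 1 ≤ γ) (ε : ℝ) (hε : 0 < ε) :
    ∃ lstar istar : ℝ,
      Tendsto
        (fun N : ℕ => (1 / (N : ℝ) ^ 2) *
          Real.log (ℙ {ω | lppSupR (fun p => u p ω) ⌊γ * N⌋₊ N ≤
            N * ((1 + Real.sqrt γ) ^ 2 - ε)}).toReal)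
        atTop (nhds (-lstar)) ∧
      Tendsto
        (fun N : ℕ => (1 / (N : ℝ)) *
          Real.log (ℙ {ω | N * ((1 + Real.sqrt γ) ^ 2 + ε) ≤
            lppSupR (fun p => u p ω) ⌊γ * N⌋₊ N}).toReal)
        atTop (nhds (-istar)) := by
  obtain ⟨l, hl⟩ := (isExpWeights_max_zero hmeas hindep hexp).exists_tendsto_lowerTail hγ
    ((1 + Real.sqrt γ) ^ 2 - ε)
  obtain ⟨i, hi⟩ := (isExpWeights_max_zero hmeas hindep hexp).exists_tendsto_upperTail hγ
    ((1 + Real.sqrt γ) ^ 2 + ε)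
  refine ⟨l, i, hl.congr' ?_, hi.congr' ?_⟩
  all_goals
    filter_upwards [eventually_ge_atTop 1] with N hN
    have hae := ae_lppSupR_eq_lastPassage hexp
      (hN.trans (floor_mul_sub_bounds hγ hN).1) hN
    congr 3
    refine measure_congr ?_
    filter_upwards [hae] with ω hω
    apply propext
  · change lastPassage (fun p => max (u p ω) 0) _ _ ≤ _ ↔ lppSupR (fun p => u p ω) _ _ ≤ _
    rw [hω]
  · change _ ≤ lastPassage (fun p => max (u p ω) 0) _ _ ↔ _ ≤ lppSupR (fun p => u p ω) _ _
    rw [hω]
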